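/- Let T : X → X be an open, distance expanding, topologically transitive map of a compact metric space X and φ : X → ℝ a continuous potential. Fix a φ-conformal measure ν and r > 0, and fix a metric dist on Borel probability measures compatible with the weak* topology. Then for every 0 < ε < r there exist n_0 ≥ 1 and κ > 0 such that ν({x ∈ X : dist(σ_n(x), K_r(φ)) ≥ ε}) < κ · exp(n(ε − r)) for all n ≥ n_0. -/

import Mathlib

open MeasureTheory Filter Set Topology
open scoped ENNReal NNReal



section MetricDefs

variable {X : Type*} [MetricSpace X] [MeasurableSpace X] [BorelSpace X]

/-- `T` is distance expanding: there are `λ > 1` and `η > 0` with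
`d(x,y) < 2η → d(Tx,Ty) ≥ λ d(x,y)`. -/
def DistanceExpanding (T : X → X) : Prop :=
  ∃ lam η : ℝ, 1 < lam ∧ 0 < η ∧
    ∀ x y : X, dist x y < 2 * η → lam * dist x y ≤ dist (T x) (T y)

/-- Topological transitivity. -/
def TopTransitive (T : X → X) : Prop :=
  ∀ U V : Set X, IsOpen U → IsOpen V → U.Nonempty → V.Nonempty →
    ∃ n : ℕ, (T^[n] '' U ∩ V).Nonempty

/-- Topological exactness. -/
def TopExact (T : X → X) : Prop :=
  ∀ U : Set X, IsOpen U → U.Nonempty → ∃ N : ℕ, T^[N] '' U = Set.univ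

/-- Ruelle–Perron–Frobenius transfer operator `L_φ g (x) = ∑_{T y = x} e^{φ y} g y`. -/
noncomputable def transferOp (T : X → X) (φ : X → ℝ) (g : X → ℝ) (x : X) : ℝ :=
  ∑' y : (T ⁻¹' {x} : Set X), Real.exp (φ y) * g y

/-- `ν` is a `φ`-conformal measure with eigenvalue `lam`: `L_φ^* ν = lam • ν`. -/
def IsConformal (T : X → X) (φ : X → ℝ) (ν : Measure X) (lam : ℝ) : Prop :=
  0 < lam ∧ ∀ g : C(X, ℝ), ∫ x, transferOp T φ (⇑g) x ∂ν = lam * ∫ x, g x ∂ν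

/-- Birkhoff sum `S_n φ (x)`. -/
noncomputable def birkhoff (T : X → X) (φ : X → ℝ) (n : ℕ) (x : X) : ℝ :=
  ∑ j ∈ Finset.range n, φ (T^[j] x)

/-- The empirical probability measures `σ_n(x) = (1/n) ∑_{j<n} δ_{T^j x}` (with the
irrelevant convention `σ_0(x) = δ_x`). -/
noncomputable def empirical (T : X → X) (x : X) (n : ℕ) : ProbabilityMeasure X :=
  if h : n = 0 then ⟨Measure.dirac x, inferInstance⟩
  else ⟨(n : ℝ≥0∞)⁻¹ • ∑ j ∈ Finset.range n, Measure.dirac (T^[j] x), by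
    constructor
    rw [Measure.smul_apply, Measure.finset_sum_apply]
    simp [ENNReal.inv_mul_cancel, h]⟩

/-- `μ` is a `T`-invariant (Borel probability) measure. -/
def InvariantProb (T : X → X) (μ : ProbabilityMeasure X) : Prop :=
  (μ : Measure X).map T = (μ : Measure X)

/-- The set `pω(x)` of weak* limit points of the empirical measures of `x`. -/
def pOmega (T : X → X) (x : X) : Set (ProbabilityMeasure X) :=
  {μ | MapClusterPt μ atTop (empirical T x)}

/-- `dP` is a metric on the space of Borel probability measures which is compatible with
the weak* topology. -/
def IsWeakStarMetric (dP : ProbabilityMeasure X → ProbabilityMeasure X → ℝ) : Prop :=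
  (∀ μ ν, dP μ ν = dP ν μ) ∧ (∀ μ ν, dP μ ν = 0 ↔ μ = ν) ∧
  (∀ μ ν ρ, dP μ ρ ≤ dP μ ν + dP ν ρ) ∧
  (∀ μ : ProbabilityMeasure X, ∀ s : Set (ProbabilityMeasure X),
      s ∈ nhds μ ↔ ∃ ε > 0, {ρ | dP ρ μ < ε} ⊆ s)

/-- The basin `A_ε(μ)` of `ε`-weak statistical attraction of `μ`. -/
noncomputable def Abasin (T : X → X) (dP : ProbabilityMeasure X → ProbabilityMeasure X → ℝ)
    (μ : ProbabilityMeasure X) (ε : ℝ) : Set X :=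
  {x | sInf ((fun ρ => dP ρ μ) '' pOmega T x) < ε}

/-- The ergodic basin `B(μ) = {x : pω(x) = {μ}}`. -/
def Bbasin (T : X → X) (μ : ProbabilityMeasure X) : Set X :=
  {x | pOmega T x = {μ}}

/-- The `ε`-pseudo basin `A_{ε,n}(μ)` of `μ` up to time `n`. -/
noncomputable def Apseudo (T : X → X) (dP : ProbabilityMeasure X → ProbabilityMeasure X → ℝ)
    (μ : ProbabilityMeasure X) (ε : ℝ) (n : ℕ) : Set X :=
  {x | dP (empirical T x n) μ < ε}

/-- `μ` is `ν`-SRB (`ν`-physical). -/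
def IsSRB (T : X → X) (ν : Measure X) (μ : ProbabilityMeasure X) : Prop :=
  InvariantProb T μ ∧ 0 < ν (Bbasin T μ)

/-- `μ` is `ν`-SRB-like (`ν`-physical-like). -/
def IsSRBLike (T : X → X) (ν : Measure X) (dP : ProbabilityMeasure X → ProbabilityMeasure X → ℝ)
    (μ : ProbabilityMeasure X) : Prop :=
  InvariantProb T μ ∧ ∀ ε > 0, 0 < ν (Abasin T dP μ ε)

/-- `μ` is `ν`-weak-SRB-like: `limsup (1/n) log ν(A_{ε,n}(μ)) = 0` for all `ε > 0`. -/
def IsWeakSRBLike (T : X → X) (ν : Measure X)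
    (dP : ProbabilityMeasure X → ProbabilityMeasure X → ℝ) (μ : ProbabilityMeasure X) : Prop :=
  InvariantProb T μ ∧ ∀ ε > 0,
    Filter.limsup
      (fun n : ℕ => (((n : ℝ)⁻¹ : ℝ) : EReal) * ENNReal.log (ν (Apseudo T dP μ ε n)))
      Filter.atTop = 0

/-- The entropy of the `n`-th dynamical refinement of the finite partition `P`
with respect to `μ`. -/
noncomputable def dynEnt (T : X → X) (μ : Measure X) {k : ℕ} (P : Fin k → Set X) (n : ℕ) : ℝ :=
  ∑ c : Fin n → Fin k, Real.negMulLog (μ (⋂ j : Fin n, T^[(j : ℕ)] ⁻¹' P (c j))).toReal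

/-- Measure-theoretic (Kolmogorov–Sinai) entropy `h_μ(T)`: the supremum over finite Borel
partitions `P` of `lim_n (1/n) H(⋁_{j<n} T^{-j} P, μ)`. -/
noncomputable def metricEntropy (T : X → X) (μ : Measure X) : EReal :=
  ⨆ (k : ℕ) (P : Fin k → Set X) (_ : ∀ i, MeasurableSet (P i))
      (_ : Pairwise (Function.onFun Disjoint P)) (_ : ⋃ i, P i = Set.univ),
    Filter.liminf (fun n : ℕ => (((n : ℝ)⁻¹ * dynEnt T μ P n : ℝ) : EReal)) Filter.atTop

/-- `E` is an `(n, ε)`-separated set. -/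
def IsSeparated (T : X → X) (n : ℕ) (ε : ℝ) (E : Set X) : Prop :=
  ∀ x ∈ E, ∀ y ∈ E, x ≠ y → ∃ j < n, ε < dist (T^[j] x) (T^[j] y)

/-- `sup { ∑_{x ∈ E} e^{S_n φ(x)} : E (n,ε)-separated }`. -/
noncomputable def presSum (T : X → X) (φ : X → ℝ) (n : ℕ) (ε : ℝ) : ℝ≥0∞ :=
  ⨆ (E : Finset X) (_ : IsSeparated T n ε ↑E), ∑ x ∈ E, ENNReal.ofReal (Real.exp (birkhoff T φ n x))

/-- Topological pressure of `φ` (via `(n,ε)`-separated sets). -/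
noncomputable def topPressure (T : X → X) (φ : X → ℝ) : EReal :=
  Filter.limsup (fun ε : ℝ =>
      Filter.limsup (fun n : ℕ => (((n : ℝ)⁻¹ : ℝ) : EReal) * ENNReal.log (presSum T φ n ε))
        Filter.atTop)
    (nhdsWithin (0 : ℝ) (Set.Ioi 0))

/-- `μ` is an equilibrium state for the potential `φ`:
`h_μ(T) + ∫ φ dμ = P_top(T, φ)`. -/
def IsEquilibrium (T : X → X) (φ : X → ℝ) (μ : ProbabilityMeasure X) : Prop :=
  InvariantProb T μ ∧
    metricEntropy T (μ : Measure X) + ((∫ x, φ x ∂(μ : Measure X) : ℝ) : EReal) = topPressure T φ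

/-- `K_r(φ)`: invariant measures with `h_μ(T) + ∫φ dμ ≥ P_top(T,φ) - r`. -/
def Kset (T : X → X) (φ : X → ℝ) (r : ℝ) : Set (ProbabilityMeasure X) :=
  {μ | InvariantProb T μ ∧
    topPressure T φ - (r : EReal) ≤
      metricEntropy T (μ : Measure X) + ((∫ x, φ x ∂(μ : Measure X) : ℝ) : EReal)}

/-- The dynamical ball `B(x, n, δ)`. -/
def dynBall (T : X → X) (x : X) (n : ℕ) (δ : ℝ) : Set X :=
  {y | ∀ j < n, dist (T^[j] x) (T^[j] y) ≤ δ}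

/-- The local entropy `h_ν(T,x) = lim_{δ→0} limsup_n -(1/n) log ν(B(x,n,δ))`. -/
noncomputable def localEntropy (T : X → X) (ν : Measure X) (x : X) : EReal :=
  Filter.limsup (fun δ : ℝ =>
      Filter.limsup
        (fun n : ℕ => (((n : ℝ)⁻¹ : ℝ) : EReal) * (- ENNReal.log (ν (dynBall T x n δ))))
        Filter.atTop)
    (nhdsWithin (0 : ℝ) (Set.Ioi 0))

/-- `h_ν(T,μ)`: the `μ`-essential supremum of `x ↦ h_ν(T,x)`. -/
noncomputable def localEntropySup (T : X → X) (ν : Measure X) (μ : Measure X) : EReal :=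
  essSup (localEntropy T ν) μ

/-- `c` is an ergodic decomposition of the `T`-invariant measure `μ`. -/
def IsErgodicDecomp (T : X → X) (μ : ProbabilityMeasure X) (c : X → ProbabilityMeasure X) : Prop :=
  Measurable (fun x => (c x : Measure X)) ∧
  (∀ᵐ x ∂(μ : Measure X), Ergodic T ((c x) : Measure X)) ∧
  (∀ A : Set X, MeasurableSet A → (μ : Measure X) A = ∫⁻ x, (c x : Measure X) A ∂(μ : Measure X))

/-- A probability measure is atomic if it is supported on a finite set. -/
def IsAtomicMeasure (μ : ProbabilityMeasure X) : Prop :=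
  ∃ S : Set X, S.Finite ∧ (μ : Measure X) S = 1

end MetricDefs

section Dynamics

variable {X : Type*} [MetricSpace X]

theorem eq_of_map_eq_of_dist_lt {T : X → X} {l η : ℝ} (hl : 1 < l)
    (hexp : ∀ x y : X, dist x y < 2 * η → l * dist x y ≤ dist (T x) (T y))
    {x y : X} (hT : T x = T y) (hd : dist x y < 2 * η) : x = y := by
  have h := hexp x y hd
  rw [hT, dist_self] at h
  have h0 : dist x y ≤ 0 := by nlinarith [dist_nonneg (x := x) (y := y)]
  exact dist_le_zero.1 h0

theorem finite_of_pairwise_dist [CompactSpace X] {s : Set X} {δ : ℝ} (hδ : 0 < δ)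
    (hs : ∀ x ∈ s, ∀ y ∈ s, dist x y < δ → x = y) : s.Finite := by
  obtain ⟨t, -, ht, hcov⟩ := finite_cover_balls_of_compact (isCompact_univ (X := X)) (half_pos hδ)
  refine (ht.biUnion (t := fun c => s ∩ Metric.ball c (δ / 2)) fun c _ => ?_).subset ?_
  · refine Set.Subsingleton.finite fun x hx y hy => hs x hx.1 y hy.1 ?_
    have h1 := Metric.mem_ball.1 hx.2
    have h2 := Metric.mem_ball'.1 hy.2
    linarith [dist_triangle x c y]
  · intro x hx
    have := hcov (mem_univ x)
    simp only [mem_iUnion, exists_prop] at this ⊢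
    obtain ⟨c, hc, hxc⟩ := this
    exact ⟨c, hc, hx, hxc⟩

theorem finite_fiber [CompactSpace X] {T : X → X} {l η : ℝ} (hl : 1 < l) (hη : 0 < η)
    (hexp : ∀ x y : X, dist x y < 2 * η → l * dist x y ≤ dist (T x) (T y)) (x : X) :
    (T ⁻¹' {x}).Finite :=
  finite_of_pairwise_dist (δ := 2 * η) (by positivity) fun y hy z hz hd =>
    eq_of_map_eq_of_dist_lt hl hexp (hy.trans hz.symm) hd

theorem exists_ball_subset_image_ball [CompactSpace X] {T : X → X} (hcont : Continuous T)
    (hopen : IsOpenMap T) {η : ℝ} (hη : 0 < η) :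
    ∃ ξ > 0, ∀ x, Metric.ball (T x) ξ ⊆ T '' Metric.ball x η := by
  suffices h : ∃ ξ > 0, ∀ x ∈ (univ : Set X), Metric.ball (T x) ξ ⊆ T '' Metric.ball x η by
    simpa using h
  refine IsCompact.induction_on
    (p := fun s => ∃ ξ > 0, ∀ x ∈ s, Metric.ball (T x) ξ ⊆ T '' Metric.ball x η)
    isCompact_univ ⟨1, one_pos, by simp⟩ ?_ ?_ ?_
  · rintro s t hst ⟨ξ, h0, h⟩
    exact ⟨ξ, h0, fun x hx => h x (hst hx)⟩
  · rintro s t ⟨ξ, h0, h⟩ ⟨ζ, h0', h'⟩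
    refine ⟨min ξ ζ, lt_min h0 h0', fun x hx => ?_⟩
    rcases hx with hx | hx
    · exact (Metric.ball_subset_ball (min_le_left _ _)).trans (h x hx)
    · exact (Metric.ball_subset_ball (min_le_right _ _)).trans (h' x hx)
  · intro x _
    have hmem : T '' Metric.ball x (η / 2) ∈ 𝓝 (T x) :=
      (hopen _ Metric.isOpen_ball).mem_nhds ⟨x, Metric.mem_ball_self (by positivity), rfl⟩
    obtain ⟨ρ, hρ, hsub⟩ := Metric.mem_nhds_iff.1 hmem
    refine ⟨Metric.ball x (η / 2) ∩ T ⁻¹' Metric.ball (T x) (ρ / 2), mem_nhdsWithin_of_mem_nhds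
      (inter_mem (Metric.ball_mem_nhds _ (by positivity))
        (hcont.continuousAt.preimage_mem_nhds (Metric.ball_mem_nhds _ (by positivity)))),
      ρ / 2, by positivity, ?_⟩
    rintro y ⟨hy1, hy2⟩ z hz
    have h1 : z ∈ Metric.ball (T x) ρ := by
      have := Metric.mem_ball.1 hz
      have := Metric.mem_ball.1 hy2
      rw [Metric.mem_ball]
      linarith [dist_triangle z (T y) (T x)]
    obtain ⟨w, hw, rfl⟩ := hsub h1
    refine ⟨w, ?_, rfl⟩
    have := Metric.mem_ball.1 hw
    have := Metric.mem_ball'.1 hy1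
    rw [Metric.mem_ball]
    linarith [dist_triangle w x y]

/-- Uniform existence of contracting inverse branches. -/
theorem exists_inverse_branch [CompactSpace X] {T : X → X} (hcont : Continuous T)
    (hopen : IsOpenMap T) {l η : ℝ} (hη : 0 < η)
    (hexp : ∀ x y : X, dist x y < 2 * η → l * dist x y ≤ dist (T x) (T y)) :
    ∃ ξ > 0, ∀ x z, dist z (T x) < ξ → ∃ y, T y = z ∧ l * dist y x ≤ dist z (T x) := by
  obtain ⟨ξ, hξ, h⟩ := exists_ball_subset_image_ball hcont hopen hη
  refine ⟨ξ, hξ, fun x z hz => ?_⟩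
  obtain ⟨y, hy, rfl⟩ := h x (Metric.mem_ball.2 hz)
  exact ⟨y, rfl, hexp y x (by linarith [Metric.mem_ball.1 hy])⟩

theorem exists_inverse_branch_iterate {T : X → X} {l ξ : ℝ} (hl : 1 < l)
    (hinv : ∀ x z, dist z (T x) < ξ → ∃ y, T y = z ∧ l * dist y x ≤ dist z (T x)) (n : ℕ) :
    ∀ x z, dist z (T^[n] x) < ξ → ∃ y, T^[n] y = z ∧ l ^ n * dist y x ≤ dist z (T^[n] x) := by
  induction n with
  | zero => exact fun x z _ => ⟨z, rfl, by simp⟩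
  | succ n ih =>
    intro x z hz
    rw [Function.iterate_succ_apply] at hz ⊢
    obtain ⟨w, hw, hwd⟩ := ih (T x) z hz
    have h1 : 1 ≤ l ^ n := one_le_pow₀ hl.le
    have h2 : dist w (T x) ≤ dist z (T^[n] (T x)) := by
      nlinarith [dist_nonneg (x := w) (y := T x)]
    obtain ⟨y, hy, hyd⟩ := hinv x w (h2.trans_lt hz)
    refine ⟨y, by rw [Function.iterate_succ_apply, hy, hw], ?_⟩
    calc l ^ (n + 1) * dist y x = l ^ n * (l * dist y x) := by ring
      _ ≤ l ^ n * dist w (T x) := by gcongr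
      _ ≤ _ := hwd

theorem surjective_of_topTransitive [CompactSpace X] {T : X → X} (hcont : Continuous T)
    (hopen : IsOpenMap T) (htr : TopTransitive T) : Function.Surjective T := by
  intro z
  by_contra hz
  have hz' : z ∉ range T := hz
  obtain ⟨n, x, ⟨y, ⟨w, hw⟩, rfl⟩, hx⟩ := htr (range T) (range T)ᶜ hopen.isOpen_range
    (isCompact_range hcont).isClosed.isOpen_compl ⟨T z, z, rfl⟩ ⟨z, hz'⟩
  refine hx ⟨T^[n] w, ?_⟩
  rw [← hw, ← Function.iterate_succ_apply' T n w, Function.iterate_succ_apply]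

/-- The forward images of a nonempty open set cover the space. -/
theorem exists_mem_iterate_image [CompactSpace X] {T : X → X} (hcont : Continuous T)
    (hopen : IsOpenMap T) (hde : DistanceExpanding T) (htr : TopTransitive T) {U : Set X}
    (hU : IsOpen U) (hne : U.Nonempty) (z : X) : ∃ n, z ∈ T^[n] '' U := by
  obtain ⟨l, η, hl, hη, hexp⟩ := hde
  obtain ⟨ξ, hξ, hinv⟩ := exists_inverse_branch hcont hopen hη hexp
  obtain ⟨p, hp⟩ := hne
  obtain ⟨ρ, hρ, hsub⟩ := Metric.isOpen_iff.1 hU p hp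
  obtain ⟨N, hN⟩ := pow_unbounded_of_one_lt (ξ / (ρ / 2)) hl
  have hsurj := (surjective_of_topTransitive hcont hopen htr).iterate N
  obtain ⟨m, x, ⟨u, hu, rfl⟩, hx⟩ := htr (Metric.ball p (ρ / 2)) (T^[N] ⁻¹' Metric.ball z ξ)
    Metric.isOpen_ball (Metric.isOpen_ball.preimage (hcont.iterate N))
    ⟨p, Metric.mem_ball_self (by positivity)⟩
    (Set.Nonempty.preimage ⟨z, Metric.mem_ball_self hξ⟩ hsurj)
  rw [mem_preimage, ← Function.iterate_add_apply] at hx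
  obtain ⟨y, hy, hyd⟩ := exists_inverse_branch_iterate hl hinv (N + m) u z (Metric.mem_ball'.1 hx)
  refine ⟨N + m, y, hsub ?_, hy⟩
  have h1 : l ^ N ≤ l ^ (N + m) := pow_le_pow_right₀ hl.le (by omega)
  have h2 : dist y u < ρ / 2 := by
    by_contra! hcon
    rw [div_lt_iff₀ (by positivity)] at hN
    have h3 : l ^ N * (ρ / 2) ≤ l ^ (N + m) * dist y u := by gcongr
    linarith [Metric.mem_ball'.1 hx]
  rw [Metric.mem_ball]
  linarith [dist_triangle y u p, Metric.mem_ball.1 hu]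

end Dynamics

section Conformal

theorem integrable_transferOp {X : Type*} [MetricSpace X] [MeasurableSpace X]
    {T : X → X} {φ : X → ℝ} {ν : Measure X} [IsProbabilityMeasure ν]
    {lam : ℝ} (hν : IsConformal T φ ν lam) {g : C(X, ℝ)} (hg : ∫ x, g x ∂ν ≠ 0) :
    Integrable (transferOp T φ g) ν := by
  by_contra h
  have := hν.2 g
  rw [integral_undef h] at this
  exact mul_ne_zero hν.1.ne' hg this.symm

variable {X : Type*} [MetricSpace X] [MeasurableSpace X] [BorelSpace X] [CompactSpace X]

theorem IsConformal.le_measure {T : X → X} (hcont : Continuous T) {φ : X → ℝ} {ν : Measure X}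
    [IsProbabilityMeasure ν] {lam : ℝ} (hν : IsConformal T φ ν lam)
    (hfin : ∀ x, (T ⁻¹' {x}).Finite) {A : Set X} (hA : IsClosed A) {m : ℝ}
    (hm : ∀ y ∈ A, m ≤ Real.exp (φ y)) : m * ν.real (T '' A) ≤ lam * ν.real A := by
  have hlam := hν.1
  have hTA : IsClosed (T '' A) := (hA.isCompact.image hcont).isClosed
  have key : ∀ W : Set X, IsOpen W → A ⊆ W → ∀ c : ℝ, 0 < c →
      m * ν.real (T '' A) ≤ lam * (ν.real W + c) := by
    intro W hW hAW c hc
    obtain ⟨f, hf0, hf1, hf⟩ := exists_continuous_zero_one_of_isClosed hW.isClosed_compl hA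
      (disjoint_left.2 fun x hx hxA => hx (hAW hxA))
    have hfi : Integrable f ν := f.continuous.integrable_of_hasCompactSupport
      (HasCompactSupport.of_compactSpace _)
    let g : C(X, ℝ) := f + ContinuousMap.const X c
    have hg : ∀ x, g x = f x + c := fun x => rfl
    have hg0 : ∀ x, 0 ≤ g x := fun x => by rw [hg]; linarith [(hf x).1]
    have hgi : ∫ x, g x ∂ν = ∫ x, f x ∂ν + c := by
      simp_rw [hg]
      rw [integral_add hfi (integrable_const c)]
      simp
    have hf0' : 0 ≤ ∫ x, f x ∂ν := integral_nonneg fun x => (hf x).1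
    have hintegrable := integrable_transferOp hν (g := g) (by rw [hgi]; positivity)
    have hfW : ∫ x, f x ∂ν ≤ ν.real W := by
      rw [← integral_indicator_one hW.measurableSet]
      refine integral_mono hfi ((integrable_const 1).indicator hW.measurableSet) fun x => ?_
      by_cases hx : x ∈ W
      · simpa [hx] using (hf x).2
      · simpa [hx] using (hf0 hx).le
    have hle : m * ν.real (T '' A) ≤ ∫ x, transferOp T φ g x ∂ν := by
      have : m * ν.real (T '' A) = ∫ x, (T '' A).indicator (fun _ => m) x ∂ν := by
        rw [integral_indicator_const _ hTA.measurableSet, smul_eq_mul, mul_comm]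
      rw [this]
      refine integral_mono ((integrable_const m).indicator hTA.measurableSet) hintegrable fun x => ?_
      have hnn : ∀ y : (T ⁻¹' {x} : Set X), 0 ≤ Real.exp (φ y) * g y := fun y =>
        mul_nonneg (Real.exp_pos _).le (hg0 _)
      by_cases hx : x ∈ T '' A
      · rw [indicator_of_mem hx]
        obtain ⟨y, hy, hyx⟩ := hx
        have := (hfin x).to_subtype
        have h1 := (Summable.of_finite (L := SummationFilter.unconditional _)
          (f := fun y : (T ⁻¹' {x} : Set X) =>
          Real.exp (φ y) * g y)).le_tsum ⟨y, hyx⟩ fun z _ => hnn z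
        refine (hm y hy).trans (le_trans ?_ h1)
        have : g y = 1 + c := by rw [hg, hf1 hy]; rfl
        simp only [this]
        nlinarith [Real.exp_pos (φ y)]
      · rw [indicator_of_notMem hx]
        exact tsum_nonneg hnn
    rw [hν.2 g, hgi] at hle
    exact hle.trans (by gcongr)
  refine le_of_forall_pos_le_add fun e he => ?_
  obtain ⟨W, hAW, hW, hlt⟩ := A.exists_isOpen_lt_add (measure_ne_top ν A)
    (ε := ENNReal.ofReal (e / (2 * lam))) (by simpa using by positivity)
  have h1 : ν.real W ≤ ν.real A + e / (2 * lam) := by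
    have := ENNReal.toReal_mono (by finiteness) hlt.le
    rwa [ENNReal.toReal_add (by finiteness) (by finiteness),
      ENNReal.toReal_ofReal (by positivity)] at this
  refine (key W hW hAW (e / (2 * lam)) (by positivity)).trans ?_
  calc lam * (ν.real W + e / (2 * lam))
      ≤ lam * (ν.real A + e / (2 * lam) + e / (2 * lam)) := by gcongr
    _ = _ := by field_simp; ring

theorem IsConformal.measure_le {T : X → X} (hcont : Continuous T)
    {φ : X → ℝ} {ν : Measure X}
    [IsProbabilityMeasure ν] {lam : ℝ} (hν : IsConformal T φ ν lam)
    {A U : Set X} (hA : IsClosed A) (hU : IsOpen U) (hAU : A ⊆ U) (hinj : InjOn T U) {M : ℝ}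
    (hM0 : 0 < M) (hM : ∀ y ∈ U, Real.exp (φ y) ≤ M) : lam * ν.real A ≤ M * ν.real (T '' A) := by
  have hlam := hν.1
  have key : ∀ W : Set X, IsOpen W → T '' A ⊆ W → lam * ν.real A ≤ M * ν.real W := by
    intro W hW hAW
    have hV : IsOpen (U ∩ T ⁻¹' W) := hU.inter (hW.preimage hcont)
    have hAV : A ⊆ U ∩ T ⁻¹' W := fun y hy => ⟨hAU hy, hAW ⟨y, hy, rfl⟩⟩
    obtain ⟨f, hf0, hf1, hf⟩ := exists_continuous_zero_one_of_isClosed hV.isClosed_compl hA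
      (disjoint_left.2 fun x hx hxA => hx (hAV hxA))
    have hfi : Integrable f ν := f.continuous.integrable_of_hasCompactSupport
      (HasCompactSupport.of_compactSpace _)
    have hfA : ν.real A ≤ ∫ x, f x ∂ν := by
      rw [← integral_indicator_one hA.measurableSet]
      refine integral_mono ((integrable_const 1).indicator hA.measurableSet) hfi fun x => ?_
      by_cases hx : x ∈ A
      · simpa [hx] using (hf1 hx).ge
      · simpa [hx] using (hf x).1
    have hle : ∫ x, transferOp T φ f x ∂ν ≤ M * ν.real W := by
      have : M * ν.real W = ∫ x, W.indicator (fun _ => M) x ∂ν := by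
        rw [integral_indicator_const _ hW.measurableSet, smul_eq_mul, mul_comm]
      rw [this]
      refine integral_mono_of_nonneg (Eventually.of_forall fun x => tsum_nonneg fun y =>
        mul_nonneg (Real.exp_pos _).le (hf _).1)
        ((integrable_const M).indicator hW.measurableSet) (Eventually.of_forall fun x => ?_)
      by_cases hx : ∃ y ∈ U ∩ T ⁻¹' W, T y = x
      · obtain ⟨y, hy, hyx⟩ := hx
        have hxW : x ∈ W := hyx ▸ hy.2
        rw [indicator_of_mem hxW]
        have : transferOp T φ f x = Real.exp (φ y) * f y := by
          refine tsum_eq_single (⟨y, hyx⟩ : (T ⁻¹' {x} : Set X)) fun z hz => ?_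
          have hzn : (z : X) ∉ U ∩ T ⁻¹' W := fun hzV =>
            hz (Subtype.ext (hinj hzV.1 hy.1 (by rw [hyx]; exact z.2)))
          rw [hf0 hzn]
          simp
        rw [this]
        nlinarith [hM y hy.1, (hf y).1, (hf y).2, Real.exp_pos (φ y)]
      · have : transferOp T φ f x = 0 := by
          refine (tsum_congr fun z => ?_).trans tsum_zero
          have hzn : (z : X) ∉ U ∩ T ⁻¹' W := fun hzV => hx ⟨z, hzV, z.2⟩
          rw [hf0 hzn]
          simp
        rw [this]
        exact indicator_nonneg (fun _ _ => hM0.le) _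
    rw [hν.2 f] at hle
    exact le_trans (by gcongr) hle
  refine le_of_forall_pos_le_add fun e he => ?_
  obtain ⟨W, hAW, hW, hlt⟩ := (T '' A).exists_isOpen_lt_add (measure_ne_top ν _)
    (ε := ENNReal.ofReal (e / M)) (by simpa using by positivity)
  have h1 : ν.real W ≤ ν.real (T '' A) + e / M := by
    have := ENNReal.toReal_mono (by finiteness) hlt.le
    rwa [ENNReal.toReal_add (by finiteness) (by finiteness),
      ENNReal.toReal_ofReal (by positivity)] at this
  refine (key W hW hAW).trans ?_
  calc M * ν.real W ≤ M * (ν.real (T '' A) + e / M) := by gcongr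
    _ = _ := by field_simp

end Conformal

section DynamicalBalls

theorem birkhoff_succ {X : Type*} (T : X → X) (φ : X → ℝ) (n : ℕ) (x : X) :
    birkhoff T φ (n + 1) x = φ x + birkhoff T φ n (T x) := by
  simp [birkhoff, Finset.sum_range_succ', add_comm]

variable {X : Type*} [MetricSpace X]

theorem isClosed_dynBall {T : X → X} (hcont : Continuous T) (x : X) (n : ℕ) (δ : ℝ) :
    IsClosed (dynBall T x n δ) := by
  simp only [dynBall, ofPred_forall]
  exact isClosed_iInter fun j => isClosed_iInter fun _ =>
    isClosed_le (continuous_const.dist (hcont.iterate j)) continuous_const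

theorem image_dynBall_subset {T : X → X} (x : X) (n : ℕ) (δ : ℝ) :
    T '' dynBall T x (n + 1) δ ⊆ dynBall T (T x) n δ := by
  rintro _ ⟨y, hy, rfl⟩ j hj
  simpa [Function.iterate_succ_apply] using hy (j + 1) (by omega)

theorem mem_dynBall_succ {T : X → X} {x y : X} {n : ℕ} {δ : ℝ} :
    y ∈ dynBall T x (n + 1) δ ↔ dist x y ≤ δ ∧ T y ∈ dynBall T (T x) n δ := by
  constructor
  · exact fun h => ⟨h 0 (by omega), image_dynBall_subset x n δ ⟨y, h, rfl⟩⟩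
  · rintro ⟨h0, h⟩ j hj
    cases j with
    | zero => exact h0
    | succ j => exact h j (by omega)

theorem dynBall_subset_image {T : X → X} {l ξ δ : ℝ} (hl : 1 < l) (hδ : δ < ξ)
    (hinv : ∀ x z, dist z (T x) < ξ → ∃ y, T y = z ∧ l * dist y x ≤ dist z (T x))
    (x : X) (n : ℕ) :
    dynBall T (T x) (n + 1) δ ⊆ T '' dynBall T x (n + 2) δ := by
  intro z hz
  have h0 : dist (T x) z ≤ δ := hz 0 (by omega)
  rw [dist_comm] at h0
  obtain ⟨y, rfl, hyd⟩ := hinv x z (h0.trans_lt hδ)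
  refine ⟨y, mem_dynBall_succ.2 ⟨?_, hz⟩, rfl⟩
  rw [dist_comm]
  nlinarith [dist_nonneg (x := y) (y := x)]

theorem exists_pos_le_measure_closedBall [MeasurableSpace X] [CompactSpace X]
    (ν : Measure X) [IsProbabilityMeasure ν]
    [ν.IsOpenPosMeasure] {δ : ℝ} (hδ : 0 < δ) :
    ∃ c > 0, ∀ x, c ≤ ν.real (Metric.closedBall x δ) := by
  suffices h : ∃ c > 0, ∀ x ∈ (univ : Set X), c ≤ ν.real (Metric.closedBall x δ) by simpa using h
  refine IsCompact.induction_on (p := fun s => ∃ c > 0, ∀ x ∈ s, c ≤ ν.real (Metric.closedBall x δ))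
    isCompact_univ ⟨1, one_pos, by simp⟩ ?_ ?_ ?_
  · rintro s t hst ⟨c, h0, h⟩
    exact ⟨c, h0, fun x hx => h x (hst hx)⟩
  · rintro s t ⟨c, h0, h⟩ ⟨d, h0', h'⟩
    refine ⟨min c d, lt_min h0 h0', fun x hx => ?_⟩
    rcases hx with hx | hx
    · exact (min_le_left _ _).trans (h x hx)
    · exact (min_le_right _ _).trans (h' x hx)
  · intro x _
    refine ⟨Metric.ball x (δ / 2), mem_nhdsWithin_of_mem_nhds
      (Metric.ball_mem_nhds _ (half_pos hδ)), ν.real (Metric.ball x (δ / 2)), ?_, ?_⟩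
    · exact ENNReal.toReal_pos (Metric.measure_ball_pos ν x (half_pos hδ)).ne' (measure_ne_top _ _)
    · intro y hy
      refine measureReal_mono fun z hz => ?_
      rw [Metric.mem_ball] at hz
      rw [Metric.mem_ball'] at hy
      rw [Metric.mem_closedBall]
      linarith [dist_triangle z x y]

variable [MeasurableSpace X] [BorelSpace X] [CompactSpace X]

theorem IsConformal.measure_dynBall_le {T : X → X} (hcont : Continuous T) {l η : ℝ} (hl : 1 < l)
    (hexp : ∀ x y : X, dist x y < 2 * η → l * dist x y ≤ dist (T x) (T y))
    {φ : X → ℝ} {ν : Measure X} [IsProbabilityMeasure ν] {lam : ℝ} (hν : IsConformal T φ ν lam)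
    {δ γ : ℝ} (hδ : 0 < δ) (hδη : 2 * δ ≤ η) (hγ : ∀ x y, dist x y < 2 * δ → φ y ≤ φ x + γ)
    (n : ℕ) (x : X) :
    ν.real (dynBall T x n δ) ≤ Real.exp (birkhoff T φ n x + n * γ) / lam ^ n := by
  have hlam := hν.1
  induction n generalizing x with
  | zero => simp [birkhoff]
  | succ n ih =>
    have h1 := hν.measure_le hcont (A := dynBall T x (n + 1) δ) (U := Metric.ball x (2 * δ))
      (isClosed_dynBall hcont _ _ _) Metric.isOpen_ball
      (fun y hy => by
        have := (mem_dynBall_succ.1 hy).1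
        rw [Metric.mem_ball']
        linarith)
      (fun y hy z hz h => eq_of_map_eq_of_dist_lt hl hexp h (by
        have h1 := Metric.mem_ball.1 hy
        have h2 := Metric.mem_ball'.1 hz
        linarith [dist_triangle y x z]))
      (M := Real.exp (φ x + γ)) (Real.exp_pos _)
      (fun y hy => Real.exp_le_exp.2 (hγ x y (Metric.mem_ball'.1 hy)))
    have h2 : ν.real (T '' dynBall T x (n + 1) δ) ≤ ν.real (dynBall T (T x) n δ) :=
      measureReal_mono (image_dynBall_subset x n δ)
    have h3 : lam * ν.real (dynBall T x (n + 1) δ) ≤ Real.exp (φ x + γ) *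
        (Real.exp (birkhoff T φ n (T x) + n * γ) / lam ^ n) :=
      h1.trans (by gcongr; exact h2.trans (ih _))
    rw [birkhoff_succ, le_div_iff₀ (by positivity)]
    calc ν.real (dynBall T x (n + 1) δ) * lam ^ (n + 1)
        = lam * ν.real (dynBall T x (n + 1) δ) * lam ^ n := by ring
      _ ≤ Real.exp (φ x + γ) * (Real.exp (birkhoff T φ n (T x) + n * γ) / lam ^ n) * lam ^ n := by
        gcongr
      _ = Real.exp (φ x + γ) * Real.exp (birkhoff T φ n (T x) + n * γ) := by field_simp
      _ = _ := by rw [← Real.exp_add]; push_cast; ring_nf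

theorem IsConformal.le_measure_dynBall {T : X → X} (hcont : Continuous T) {l ξ : ℝ} (hl : 1 < l)
    (hinv : ∀ x z, dist z (T x) < ξ → ∃ y, T y = z ∧ l * dist y x ≤ dist z (T x))
    {φ : X → ℝ} {ν : Measure X} [IsProbabilityMeasure ν] {lam : ℝ} (hν : IsConformal T φ ν lam)
    (hfin : ∀ x, (T ⁻¹' {x}).Finite)
    {δ γ c : ℝ} (hδξ : δ < ξ) (hγ : ∀ x y, dist x y ≤ δ → φ x - γ ≤ φ y)
    (hc : ∀ x, c * Real.exp (φ x) / lam ≤ ν.real (Metric.closedBall x δ))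
    (n : ℕ) (x : X) :
    c * Real.exp (birkhoff T φ (n + 1) x - n * γ) / lam ^ (n + 1) ≤
      ν.real (dynBall T x (n + 1) δ) := by
  have hlam := hν.1
  induction n generalizing x with
  | zero =>
    have : dynBall T x (0 + 1) δ = Metric.closedBall x δ := by
      ext y
      simp [dynBall, dist_comm]
    rw [this]
    simpa [birkhoff] using hc x
  | succ n ih =>
    have h1 := hν.le_measure hcont hfin (A := dynBall T x (n + 2) δ)
      (isClosed_dynBall hcont _ _ _) (m := Real.exp (φ x - γ))
      (fun y hy => Real.exp_le_exp.2 (hγ x y (mem_dynBall_succ.1 hy).1))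
    have h2 : ν.real (dynBall T (T x) (n + 1) δ) ≤ ν.real (T '' dynBall T x (n + 2) δ) :=
      measureReal_mono (dynBall_subset_image hl hδξ hinv x n)
    have h3 : Real.exp (φ x - γ) *
        (c * Real.exp (birkhoff T φ (n + 1) (T x) - n * γ) / lam ^ (n + 1)) ≤
        lam * ν.real (dynBall T x (n + 2) δ) :=
      le_trans (by gcongr; exact (ih _).trans h2) h1
    rw [birkhoff_succ, div_le_iff₀ (by positivity)]
    calc c * Real.exp (φ x + birkhoff T φ (n + 1) (T x) - (n + 1 : ℕ) * γ)
        = c * (Real.exp (φ x - γ) * Real.exp (birkhoff T φ (n + 1) (T x) - n * γ)) := by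
          rw [← Real.exp_add]; push_cast; ring_nf
      _ = Real.exp (φ x - γ) *
        (c * Real.exp (birkhoff T φ (n + 1) (T x) - n * γ) / lam ^ (n + 1)) * lam ^ (n + 1) := by
          field_simp
      _ ≤ lam * ν.real (dynBall T x (n + 2) δ) * lam ^ (n + 1) := by gcongr
      _ = _ := by ring

/-- A conformal measure of an open expanding transitive map has full support. -/
theorem IsConformal.isOpenPosMeasure {T : X → X} (hcont : Continuous T)
    (hopen : IsOpenMap T) (hde : DistanceExpanding T) (htr : TopTransitive T)
    {φ : X → ℝ} (hφ : Continuous φ) {ν : Measure X} [IsProbabilityMeasure ν] {lam : ℝ}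
    (hν : IsConformal T φ ν lam) (hfin : ∀ x, (T ⁻¹' {x}).Finite) : ν.IsOpenPosMeasure := by
  have hlam := hν.1
  obtain ⟨M, hM⟩ := (isCompact_univ (X := X)).exists_bound_of_continuousOn hφ.continuousOn
  have himg : ∀ A : Set X, IsClosed A → ν.real A = 0 → ν.real (T '' A) = 0 := by
    intro A hA h0
    have := hν.le_measure hcont hfin hA (m := Real.exp (-M)) fun y _ =>
      Real.exp_le_exp.2 (neg_le_of_abs_le (hM y (mem_univ _)))
    rw [h0, mul_zero] at this
    nlinarith [Real.exp_pos (-M), measureReal_nonneg (μ := ν) (s := T '' A)]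
  refine ⟨fun U hU hne h0 => ?_⟩
  obtain ⟨p, hp⟩ := hne
  obtain ⟨ρ, hρ, hsub⟩ := Metric.isOpen_iff.1 hU p hp
  have hA : IsClosed (Metric.closedBall p (ρ / 2)) := Metric.isClosed_closedBall
  have hA0 : ν.real (Metric.closedBall p (ρ / 2)) = 0 := by
    rw [measureReal_def, measure_mono_null
      ((Metric.closedBall_subset_ball (by linarith)).trans hsub) h0]
    rfl
  have hiter : ∀ n, IsClosed (T^[n] '' Metric.closedBall p (ρ / 2)) ∧
      ν.real (T^[n] '' Metric.closedBall p (ρ / 2)) = 0 := by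
    intro n
    refine ⟨(hA.isCompact.image (hcont.iterate n)).isClosed, ?_⟩
    induction n with
    | zero => simpa using hA0
    | succ n ih =>
      rw [Function.iterate_succ', image_comp]
      exact himg _ (hA.isCompact.image (hcont.iterate n)).isClosed ih
  have hcov : (univ : Set X) ⊆ ⋃ n, T^[n] '' Metric.closedBall p (ρ / 2) := fun z _ => by
    obtain ⟨n, y, hy, hz⟩ := exists_mem_iterate_image hcont hopen hde htr Metric.isOpen_ball
      ⟨p, Metric.mem_ball_self (half_pos hρ)⟩ z
    exact mem_iUnion.2 ⟨n, y, Metric.ball_subset_closedBall hy, hz⟩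
  have h1 : ν univ = 0 := measure_mono_null hcov (measure_iUnion_null fun n => by
    have := (hiter n).2
    rwa [measureReal_eq_zero_iff] at this)
  simp at h1

end DynamicalBalls

section Pressure

variable {X : Type*} [MetricSpace X]

theorem presSum_le {T : X → X} {φ : X → ℝ} {n : ℕ} {δ B : ℝ}
    (h : ∀ E : Finset X, IsSeparated T n δ E → ∑ x ∈ E, Real.exp (birkhoff T φ n x) ≤ B) :
    presSum T φ n δ ≤ ENNReal.ofReal B := by
  refine iSup₂_le fun E hE => ?_
  rw [← ENNReal.ofReal_sum_of_nonneg fun x _ => (Real.exp_pos _).le]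
  exact ENNReal.ofReal_le_ofReal (h E hE)

theorem limsup_log_le {u : ℕ → ℝ≥0∞} {a b γ : ℝ} (hγ : 0 < γ)
    (h : ∀ᶠ n : ℕ in atTop, u n ≤ ENNReal.ofReal (Real.exp (n * a + b))) :
    limsup (fun n : ℕ => (((n : ℝ)⁻¹ : ℝ) : EReal) * ENNReal.log (u n)) atTop
      ≤ ((a + γ : ℝ) : EReal) := by
  have hlim : Tendsto (fun n : ℕ => a + b * (n : ℝ)⁻¹) atTop (𝓝 (a + b * 0)) :=
    tendsto_const_nhds.add (tendsto_inv_atTop_nhds_zero_nat.const_mul b)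
  have hev := hlim.eventually (gt_mem_nhds (show a + b * 0 < a + γ by linarith))
  refine limsup_le_of_le (by isBoundedDefault) ?_
  filter_upwards [h, hev, eventually_ge_atTop 1] with n hn hn' hn1
  have hn0 : (0 : ℝ) < n := by exact_mod_cast hn1
  have h1 : ENNReal.log (u n) ≤ ((n * a + b : ℝ) : EReal) := by
    refine (ENNReal.log_monotone hn).trans ?_
    rw [ENNReal.log_ofReal_of_pos (Real.exp_pos _), Real.log_exp]
  calc (((n : ℝ)⁻¹ : ℝ) : EReal) * ENNReal.log (u n)
      ≤ (((n : ℝ)⁻¹ : ℝ) : EReal) * ((n * a + b : ℝ) : EReal) :=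
        mul_le_mul_of_nonneg_left h1 (by exact_mod_cast (inv_pos.2 hn0).le)
    _ = ((a + b * (n : ℝ)⁻¹ : ℝ) : EReal) := by
        rw [← EReal.coe_mul]
        congr 1
        field_simp
    _ ≤ _ := by exact_mod_cast hn'.le

variable [MeasurableSpace X] [BorelSpace X]

theorem sum_exp_birkhoff_le {T : X → X} (hcont : Continuous T) {φ : X → ℝ} {ν : Measure X}
    [IsProbabilityMeasure ν] {n : ℕ} {δ C : ℝ} (hC : 0 < C)
    (hball : ∀ x, C * Real.exp (birkhoff T φ n x) ≤ ν.real (dynBall T x n δ)) (E : Finset X)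
    (hE : IsSeparated T n (2 * δ) E) : ∑ x ∈ E, Real.exp (birkhoff T φ n x) ≤ C⁻¹ := by
  have hdisj : (E : Set X).PairwiseDisjoint fun x => dynBall T x n δ := by
    intro x hx y hy hxy
    refine disjoint_left.2 fun z hzx hzy => ?_
    obtain ⟨j, hj, hlt⟩ := hE x hx y hy hxy
    have h1 := hzx j hj
    have h2 := hzy j hj
    rw [dist_comm] at h2
    linarith [dist_triangle (T^[j] x) (T^[j] z) (T^[j] y)]
  have h1 : C * ∑ x ∈ E, Real.exp (birkhoff T φ n x) ≤ 1 := by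
    rw [Finset.mul_sum]
    refine (Finset.sum_le_sum fun x _ => hball x).trans ?_
    rw [← measureReal_biUnion_finset hdisj fun x _ => (isClosed_dynBall hcont x n δ).measurableSet]
    exact measureReal_le_one
  rwa [← one_div, le_div_iff₀' hC]

variable [CompactSpace X]

theorem IsConformal.topPressure_le {T : X → X} (hcont : Continuous T)
    (hopen : IsOpenMap T) (hde : DistanceExpanding T) (htr : TopTransitive T)
    {φ : X → ℝ} (hφ : Continuous φ) {ν : Measure X} [IsProbabilityMeasure ν] {lam : ℝ}
    (hν : IsConformal T φ ν lam) {γ : ℝ} (hγ : 0 < γ) :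
    topPressure T φ ≤ ((Real.log lam + γ : ℝ) : EReal) := by
  have hlam := hν.1
  obtain ⟨l, η, hl, hη, hexp⟩ := id hde
  obtain ⟨ξ, hξ, hinv⟩ := exists_inverse_branch hcont hopen hη hexp
  have hfin := finite_fiber hl hη hexp
  have := hν.isOpenPosMeasure hcont hopen hde htr hφ hfin
  obtain ⟨M, hM⟩ := (isCompact_univ (X := X)).exists_bound_of_continuousOn hφ.continuousOn
  obtain ⟨δ₀, hδ₀, hosc⟩ := Metric.uniformContinuous_iff.1
    (CompactSpace.uniformContinuous_of_continuous hφ) (γ / 2) (half_pos hγ)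
  refine limsup_le_of_le (by isBoundedDefault) ?_
  have hmem : Ioo 0 (2 * min ξ δ₀) ∈ 𝓝[>] (0 : ℝ) := Ioo_mem_nhdsGT (by positivity)
  filter_upwards [hmem] with ε hε
  obtain ⟨δ, rfl⟩ : ∃ δ, ε = 2 * δ := ⟨ε / 2, by ring⟩
  have hδ : 0 < δ := by linarith [hε.1]
  have hδ' : δ < min ξ δ₀ := by linarith [hε.2]
  have hδξ : δ < ξ := hδ'.trans_le (min_le_left _ _)
  have hδδ : δ < δ₀ := hδ'.trans_le (min_le_right _ _)
  obtain ⟨c₀, hc₀, hc⟩ := exists_pos_le_measure_closedBall ν hδ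
  set c := c₀ * lam * Real.exp (-M) with hcdef
  have hcpos : 0 < c := by positivity
  have hball := hν.le_measure_dynBall hcont hl hinv hfin (γ := γ / 2) (c := c) hδξ
    (fun x y hxy => by
      have := hosc (hxy.trans_lt hδδ)
      rw [Real.dist_eq] at this
      linarith [(abs_lt.1 this).2])
    (fun x => by
      refine le_trans ?_ (hc x)
      have h1 : Real.exp (-M) * Real.exp (φ x) ≤ 1 := by
        rw [← Real.exp_add]
        exact Real.exp_le_one_iff.2 (by linarith [le_of_abs_le (hM x (mem_univ _))])
      calc c * Real.exp (φ x) / lam = c₀ * (Real.exp (-M) * Real.exp (φ x)) := by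
            rw [hcdef]; field_simp
        _ ≤ c₀ * 1 := by gcongr
        _ = c₀ := mul_one _)
  have hu : ∀ᶠ n : ℕ in atTop, presSum T φ n (2 * δ) ≤
      ENNReal.ofReal (Real.exp (n * (Real.log lam + γ / 2) + -Real.log c)) := by
    filter_upwards [eventually_ge_atTop 1] with n hn
    obtain ⟨n, rfl⟩ : ∃ m, n = m + 1 := ⟨n - 1, by omega⟩
    refine presSum_le fun E hE => ?_
    refine (sum_exp_birkhoff_le hcont (ν := ν) (C := c * Real.exp (-(n * (γ / 2))) / lam ^ (n + 1))
      (by positivity) (fun x => ?_) E hE).trans ?_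
    · refine le_trans (le_of_eq ?_) (hball n x)
      rw [sub_eq_add_neg, Real.exp_add]
      ring
    · rw [← Real.exp_log (show 0 < (c * Real.exp (-(n * (γ / 2))) / lam ^ (n + 1))⁻¹ by positivity)]
      refine Real.exp_le_exp.2 ?_
      rw [Real.log_inv, Real.log_div (by positivity) (by positivity),
        Real.log_mul (by positivity) (by positivity), Real.log_exp, Real.log_pow]
      push_cast
      linarith
  have := limsup_log_le (half_pos hγ) hu
  rwa [show Real.log lam + γ / 2 + γ / 2 = Real.log lam + γ by ring] at this

end Pressure

section LabelEntropy

variable {ι α β γ : Type*}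

open scoped Classical in
/-- The mass of the points of `E` that have label `a`. -/
noncomputable def labelMass (E : Finset ι) (p : ι → ℝ) (f : ι → α) (a : α) : ℝ :=
  ∑ y ∈ E with f y = a, p y

/-- The Shannon entropy of the labelling `f` of the finite set `E` with weights `p`. -/
noncomputable def labelEntropy (E : Finset ι) (p : ι → ℝ) (f : ι → α) : ℝ :=
  -∑ x ∈ E, p x * Real.log (labelMass E p f (f x))

variable {E : Finset ι} {p : ι → ℝ}

theorem labelMass_nonneg (hp : ∀ x ∈ E, 0 < p x) (f : ι → α) (a : α) : 0 ≤ labelMass E p f a := by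
  classical
  exact Finset.sum_nonneg fun x hx => (hp x (Finset.mem_filter.1 hx).1).le

theorem labelMass_pos (hp : ∀ x ∈ E, 0 < p x) (f : ι → α) {x : ι} (hx : x ∈ E) :
    0 < labelMass E p f (f x) := by
  classical
  exact Finset.sum_pos (fun y hy => hp y (Finset.mem_filter.1 hy).1) ⟨x, by simp [hx]⟩

theorem sum_mul_comp_label [Fintype α] (f : ι → α) (F : α → ℝ) :
    ∑ x ∈ E, p x * F (f x) = ∑ a, labelMass E p f a * F a := by
  classical
  rw [← Finset.sum_fiberwise E f]
  refine Finset.sum_congr rfl fun a _ => ?_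
  rw [labelMass, Finset.sum_mul]
  refine Finset.sum_congr (by congr) fun x hx => ?_
  rw [(Finset.mem_filter.1 hx).2]

theorem sum_labelMass [Fintype α] (f : ι → α) : ∑ a, labelMass E p f a = ∑ x ∈ E, p x := by
  simpa using (sum_mul_comp_label (E := E) (p := p) f fun _ => 1).symm

theorem labelEntropy_eq_sum [Fintype α] (f : ι → α) :
    labelEntropy E p f = ∑ a, Real.negMulLog (labelMass E p f a) := by
  rw [labelEntropy, sum_mul_comp_label f fun a => Real.log (labelMass E p f a),
    ← Finset.sum_neg_distrib]
  simp [Real.negMulLog]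

theorem labelEntropy_of_injOn {f : ι → α} (hf : InjOn f E) :
    labelEntropy E p f = -∑ x ∈ E, p x * Real.log (p x) := by
  classical
  rw [labelEntropy]
  congr 1
  refine Finset.sum_congr rfl fun x hx => ?_
  have : labelMass E p f (f x) = p x := by
    rw [labelMass, Finset.sum_eq_single_of_mem x (by simp [hx])]
    intro y hy hyx
    rw [Finset.mem_filter] at hy
    exact absurd (hf hy.1 hx hy.2) hyx
  rw [this]

theorem labelEntropy_mono (hp : ∀ x ∈ E, 0 < p x) {f : ι → α} {g : ι → β}
    (h : ∀ x ∈ E, ∀ y ∈ E, f x = f y → g x = g y) :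
    labelEntropy E p g ≤ labelEntropy E p f := by
  classical
  rw [labelEntropy, labelEntropy, neg_le_neg_iff]
  refine Finset.sum_le_sum fun x hx => mul_le_mul_of_nonneg_left ?_ (hp x hx).le
  refine Real.log_le_log (labelMass_pos hp f hx) ?_
  refine Finset.sum_le_sum_of_subset_of_nonneg (fun y hy => ?_) fun y hy _ =>
    (hp y (Finset.mem_filter.1 hy).1).le
  rw [Finset.mem_filter] at hy ⊢
  exact ⟨hy.1, h y hy.1 x hx hy.2⟩

theorem labelEntropy_le_log_card [Fintype α] (hp : ∀ x ∈ E, 0 < p x) (hsum : ∑ x ∈ E, p x = 1)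
    (f : ι → α) : labelEntropy E p f ≤ Real.log (Fintype.card α) := by
  have hE : E.Nonempty := by
    by_contra h
    rw [Finset.not_nonempty_iff_eq_empty] at h
    simp [h] at hsum
  obtain ⟨x₀, -⟩ := hE
  have : Nonempty α := ⟨f x₀⟩
  set N : ℝ := (Fintype.card α : ℝ) with hN
  have hN0 : 0 < N := by rw [hN]; exact_mod_cast Fintype.card_pos
  have h1 : ∀ x ∈ E, p x * (-Real.log (labelMass E p f (f x)) - Real.log N) ≤
      p x * ((N * labelMass E p f (f x))⁻¹ - 1) := fun x hx => by
    refine mul_le_mul_of_nonneg_left ?_ (hp x hx).le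
    have hm := labelMass_pos hp f hx
    have := Real.log_le_sub_one_of_pos (x := (N * labelMass E p f (f x))⁻¹) (by positivity)
    rw [Real.log_inv, Real.log_mul hN0.ne' hm.ne'] at this
    linarith
  have h2 := Finset.sum_le_sum h1
  have h3 : ∑ x ∈ E, p x * (N * labelMass E p f (f x))⁻¹ ≤ 1 := by
    rw [sum_mul_comp_label f fun a => (N * labelMass E p f a)⁻¹]
    calc ∑ a, labelMass E p f a * (N * labelMass E p f a)⁻¹ ≤ ∑ _a : α, N⁻¹ := by
          refine Finset.sum_le_sum fun a _ => ?_
          rcases eq_or_ne (labelMass E p f a) 0 with h0 | h0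
          · simp [h0, hN0.le]
          · rw [mul_inv, mul_left_comm, mul_inv_cancel₀ h0, mul_one]
      _ = 1 := by
          rw [Finset.sum_const, Finset.card_univ, nsmul_eq_mul, ← hN]
          field_simp
  simp only [mul_sub, Finset.sum_sub_distrib, ← Finset.sum_mul, hsum, mul_neg,
    Finset.sum_neg_distrib] at h2
  rw [labelEntropy]
  linarith

theorem labelEntropy_le_add [Fintype α] [Fintype β] (hp : ∀ x ∈ E, 0 < p x)
    (hsum : ∑ x ∈ E, p x = 1) {f : ι → α} {g : ι → β} {h : ι → γ}
    (hdet : ∀ x ∈ E, ∀ y ∈ E, f x = f y → g x = g y → h x = h y) :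
    labelEntropy E p h ≤ labelEntropy E p f + labelEntropy E p g := by
  set fg : ι → α × β := fun x => (f x, g x) with hfg
  refine (labelEntropy_mono hp (f := fg) fun x hx y hy hxy =>
    hdet x hx y hy (congrArg Prod.fst hxy) (congrArg Prod.snd hxy)).trans ?_
  have h1 : ∀ x ∈ E, p x * (Real.log (labelMass E p f (f x)) + Real.log (labelMass E p g (g x))
      - Real.log (labelMass E p fg (fg x))) ≤
      p x * (labelMass E p f (f x) * labelMass E p g (g x) / labelMass E p fg (fg x) - 1) :=
    fun x hx => by
      refine mul_le_mul_of_nonneg_left ?_ (hp x hx).le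
      have hf := labelMass_pos hp f hx
      have hg := labelMass_pos hp g hx
      have hm := labelMass_pos hp fg hx
      have := Real.log_le_sub_one_of_pos
        (x := labelMass E p f (f x) * labelMass E p g (g x) / labelMass E p fg (fg x))
        (by positivity)
      rwa [Real.log_div (by positivity) hm.ne', Real.log_mul hf.ne' hg.ne'] at this
  have h2 := Finset.sum_le_sum h1
  have h3 : ∑ x ∈ E, p x * (labelMass E p f (f x) * labelMass E p g (g x) /
      labelMass E p fg (fg x)) ≤ 1 := by
    rw [sum_mul_comp_label fg fun a =>
      labelMass E p f a.1 * labelMass E p g a.2 / labelMass E p fg a]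
    calc _ ≤ ∑ a : α × β, labelMass E p f a.1 * labelMass E p g a.2 := by
          refine Finset.sum_le_sum fun a _ => ?_
          rcases eq_or_ne (labelMass E p fg a) 0 with h0 | h0
          · simpa [h0] using mul_nonneg (labelMass_nonneg hp f a.1) (labelMass_nonneg hp g a.2)
          · rw [mul_div_cancel₀ _ h0]
      _ = 1 := by
          rw [Fintype.sum_prod_type, ← Fintype.sum_mul_sum, sum_labelMass, sum_labelMass, hsum,
            one_mul]
  simp only [mul_sub, mul_add, Finset.sum_sub_distrib, Finset.sum_add_distrib, hsum, mul_one] at h2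
  rw [labelEntropy, labelEntropy, labelEntropy]
  linarith

variable {k : ℕ}

/-- The labelling of points by the window `[j, j + m)` of the coding `c`. -/
def window (c : ι → ℕ → Fin k) (j m : ℕ) (x : ι) (i : Fin m) : Fin k := c x (j + i)

theorem window_eq_iff {c : ι → ℕ → Fin k} {j m : ℕ} {x y : ι} :
    window c j m x = window c j m y ↔ ∀ i, j ≤ i → i < j + m → c x i = c y i := by
  constructor
  · intro h i hi hi'
    have := congrFun h ⟨i - j, by omega⟩
    simpa [window, Nat.add_sub_cancel' hi] using this
  · exact fun h => funext fun i => h _ (by omega) (by omega)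

theorem labelEntropy_window_le (hp : ∀ x ∈ E, 0 < p x) (hsum : ∑ x ∈ E, p x = 1)
    (c : ι → ℕ → Fin k) (j m : ℕ) : labelEntropy E p (window c j m) ≤ m * Real.log k := by
  refine (labelEntropy_le_log_card hp hsum _).trans (le_of_eq ?_)
  simp

theorem mul_labelEntropy_window_le (hp : ∀ x ∈ E, 0 < p x) (hsum : ∑ x ∈ E, p x = 1)
    (c : ι → ℕ → Fin k) (n q : ℕ) :
    q * labelEntropy E p (window c 0 n) ≤
      q * (q * Real.log k) + ∑ j ∈ Finset.range n, labelEntropy E p (window c j q) := by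
  set G : ℕ → ℝ := fun j => labelEntropy E p (window c j (n - j)) with hG
  have hlog : 0 ≤ Real.log k := Real.log_natCast_nonneg k
  have h1 : ∀ j, G j ≤ labelEntropy E p (window c j q) + G (j + q) := fun j => by
    refine labelEntropy_le_add hp hsum fun x _ y _ hf hg => ?_
    rw [window_eq_iff] at hf hg ⊢
    intro i hi hi'
    by_cases hiq : i < j + q
    · exact hf i hi hiq
    · exact hg i (by omega) (by omega)
  have h2 : ∀ j ∈ Finset.range q, labelEntropy E p (window c 0 n) ≤ q * Real.log k + G j := by
    intro j hj
    have h3 : labelEntropy E p (window c 0 n) ≤ labelEntropy E p (window c 0 j) + G j := by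
      refine labelEntropy_le_add hp hsum fun x _ y _ hf hg => ?_
      rw [window_eq_iff] at hf hg ⊢
      intro i hi hi'
      by_cases hiq : i < j
      · exact hf i hi (by omega)
      · exact hg i (by omega) (by omega)
    refine h3.trans ?_
    gcongr
    refine (labelEntropy_window_le hp hsum c 0 j).trans ?_
    have : (j : ℝ) ≤ q := by exact_mod_cast (Finset.mem_range.1 hj).le
    gcongr
  have h4 : ∀ j ∈ Finset.range q, G (n + j) ≤ 0 := fun j _ => by
    have := labelEntropy_window_le hp hsum c (n + j) (n - (n + j))
    simpa [hG] using this
  have h5 : ∑ j ∈ Finset.range n, G j + ∑ j ∈ Finset.range q, G (n + j) =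
      ∑ j ∈ Finset.range q, G j + ∑ j ∈ Finset.range n, G (j + q) := by
    rw [← Finset.sum_range_add, add_comm n q, Finset.sum_range_add]
    simp_rw [add_comm q]
  have h6 := Finset.sum_le_sum fun j (_ : j ∈ Finset.range n) => h1 j
  have h7 := Finset.sum_le_sum h2
  have h8 := Finset.sum_nonpos h4
  simp only [Finset.sum_add_distrib, Finset.sum_const, Finset.card_range, nsmul_eq_mul] at h6 h7
  linarith

/-- The combinatorial core of the Misiurewicz argument. -/
theorem mul_entropy_le (hp : ∀ x ∈ E, 0 < p x) (hsum : ∑ x ∈ E, p x = 1)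
    (c : ι → ℕ → Fin k) {n : ℕ} (hn : n ≠ 0) (q : ℕ) (hinj : InjOn (window c 0 n) E) :
    q * -∑ x ∈ E, p x * Real.log (p x) ≤ q * (q * Real.log k) + n * ∑ a : Fin q → Fin k,
      Real.negMulLog ((n : ℝ)⁻¹ * ∑ j ∈ Finset.range n, labelMass E p (window c j q) a) := by
  rw [← labelEntropy_of_injOn hinj]
  refine (mul_labelEntropy_window_le hp hsum c n q).trans ?_
  gcongr
  simp_rw [labelEntropy_eq_sum]
  rw [Finset.sum_comm, Finset.mul_sum]
  refine Finset.sum_le_sum fun a _ => ?_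
  have hn0 : (0 : ℝ) < n := by exact_mod_cast Nat.pos_of_ne_zero hn
  have hJ := Real.concaveOn_negMulLog.le_map_sum (t := Finset.range n) (w := fun _ => (n : ℝ)⁻¹)
    (p := fun j => labelMass E p (window c j q) a) (fun _ _ => by positivity)
    (by simp [hn]) (fun j _ => labelMass_nonneg hp _ _)
  simp only [smul_eq_mul, ← Finset.mul_sum] at hJ
  rwa [← div_eq_inv_mul, div_le_iff₀' hn0] at hJ

end LabelEntropy

section NullBoundaryPartitions

variable {X : Type*} [MetricSpace X]

theorem frontier_iInter_subset_of_finite {Y κ : Type*} [TopologicalSpace Y] [Finite κ]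
    (A : κ → Set Y) : frontier (⋂ i, A i) ⊆ ⋃ i, frontier (A i) := by
  rintro x ⟨hx, hx'⟩
  rw [interior_iInter_of_finite, mem_iInter, not_forall] at hx'
  obtain ⟨i, hi⟩ := hx'
  exact mem_iUnion.2 ⟨i, closure_mono (iInter_subset _ i) hx, hi⟩

variable [MeasurableSpace X]

theorem measure_frontier_iInter_eq_zero {κ : Type*} [Finite κ] {μ : Measure X} {A : κ → Set X}
    (h : ∀ i, μ (frontier (A i)) = 0) : μ (frontier (⋂ i, A i)) = 0 :=
  measure_mono_null (frontier_iInter_subset_of_finite A)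
    (measure_iUnion_null_iff.2 h)

theorem exists_partition_null_frontier [BorelSpace X] [CompactSpace X] (μ : Measure X)
    [IsFiniteMeasure μ] {δ : ℝ} (hδ : 0 < δ) : ∃ (k : ℕ) (P : Fin k → Set X), (∀ i, MeasurableSet (P i)) ∧
      Pairwise (Function.onFun Disjoint P) ∧ ⋃ i, P i = univ ∧
      (∀ i, ∀ x ∈ P i, ∀ y ∈ P i, dist x y ≤ δ) ∧ ∀ i, μ (frontier (P i)) = 0 := by
  have hr : ∀ x : X, ∃ r ∈ Ioo 0 (δ / 2), μ (frontier (Metric.ball x r)) = 0 := fun x => by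
    simpa only [Metric.thickening_singleton] using
      exists_null_frontier_thickening μ {x} (half_pos hδ)
  choose r hr hr0 using hr
  obtain ⟨t, -, ht⟩ := isCompact_univ.elim_nhds_subcover (fun x : X => Metric.ball x (r x))
    fun x _ => Metric.ball_mem_nhds x (hr x).1
  let e := t.equivFin
  let B : Fin t.card → Set X := fun i => Metric.ball (e.symm i : X) (r (e.symm i))
  have hBm : ∀ i, MeasurableSet (B i) := fun i => Metric.isOpen_ball.measurableSet
  have hB0 : ∀ i, μ (frontier (B i)) = 0 := fun i => hr0 _
  let Q : Fin t.card → Fin t.card → Set X := fun i j =>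
    if j < i then (B j)ᶜ else if j = i then B i else univ
  have hmem : ∀ i x, x ∈ ⋂ j, Q i j ↔ x ∈ B i ∧ ∀ j < i, x ∉ B j := by
    intro i x
    rw [mem_iInter]
    constructor
    · intro h
      refine ⟨by simpa [Q] using h i, fun j hj => ?_⟩
      have := h j
      simp only [Q, if_pos hj] at this
      exact this
    · rintro ⟨h1, h2⟩ j
      simp only [Q]
      split_ifs with h3 h4
      · exact h2 j h3
      · exact h1
      · trivial
  refine ⟨t.card, fun i => ⋂ j, Q i j, fun i => MeasurableSet.iInter fun j => ?_, ?_, ?_, ?_, ?_⟩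
  · simp only [Q]
    split_ifs
    exacts [(hBm j).compl, hBm i, MeasurableSet.univ]
  · have hlt : ∀ i j, i < j → Disjoint (⋂ m, Q i m) (⋂ m, Q j m) := fun i j hij =>
      disjoint_left.2 fun x hxi hxj => ((hmem j x).1 hxj).2 i hij ((hmem i x).1 hxi).1
    intro i j hij
    rcases lt_or_gt_of_ne hij with h | h
    · exact hlt i j h
    · exact (hlt j i h).symm
  · refine eq_univ_of_forall fun x => ?_
    have hx := ht (mem_univ x)
    simp only [mem_iUnion, exists_prop] at hx
    obtain ⟨y, hy, hxy⟩ := hx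
    have hne : {i | x ∈ B i}.Nonempty := ⟨e ⟨y, hy⟩, by simpa [B] using hxy⟩
    obtain ⟨i, hi⟩ := (toFinite {i | x ∈ B i}).exists_minimal hne
    refine mem_iUnion.2 ⟨i, (hmem i x).2 ⟨hi.1, fun j hj hxj => ?_⟩⟩
    exact absurd (hi.2 hxj hj.le) (not_le.2 hj)
  · intro i x hx y hy
    have h1 := Metric.mem_ball.1 ((hmem i x).1 hx).1
    have h2 := Metric.mem_ball'.1 ((hmem i y).1 hy).1
    have h3 := (hr (e.symm i)).2
    linarith [dist_triangle x (e.symm i : X) y]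
  · refine fun i => measure_frontier_iInter_eq_zero fun j => ?_
    simp only [Q]
    split_ifs
    · rw [frontier_compl]
      exact hB0 j
    · exact hB0 i
    · simp

end NullBoundaryPartitions

section WeightedEmpirical

variable {X : Type*} [MeasurableSpace X]

theorem coe_empirical (T : X → X) (x : X) {n : ℕ} (hn : n ≠ 0) :
    (empirical T x n : Measure X) =
      (n : ℝ≥0∞)⁻¹ • ∑ j ∈ Finset.range n, Measure.dirac (T^[j] x) :=
  congrArg (fun m : ProbabilityMeasure X => (m : Measure X)) (dif_neg hn)

/-- The average of the empirical measures of the points of `E` with weights `p`. -/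
noncomputable def weightedEmpirical (T : X → X) (n : ℕ) (E : Finset X) (p : X → ℝ) : Measure X :=
  ∑ x ∈ E, ENNReal.ofReal (p x) • (empirical T x n : Measure X)

theorem isProbabilityMeasure_weightedEmpirical (T : X → X) (n : ℕ) {E : Finset X} {p : X → ℝ}
    (hp : ∀ x ∈ E, 0 < p x) (hsum : ∑ x ∈ E, p x = 1) :
    IsProbabilityMeasure (weightedEmpirical T n E p) := by
  constructor
  simp only [weightedEmpirical, Measure.finsetSum_apply, Measure.smul_apply, measure_univ,
    smul_eq_mul, mul_one]
  rw [← ENNReal.ofReal_sum_of_nonneg fun x hx => (hp x hx).le, hsum, ENNReal.ofReal_one]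

theorem integral_weightedEmpirical (T : X → X) (n : ℕ) {E : Finset X} {p : X → ℝ}
    (hp : ∀ x ∈ E, 0 < p x) {f : X → ℝ}
    (hf : ∀ x ∈ E, Integrable f (empirical T x n : Measure X)) :
    ∫ y, f y ∂(weightedEmpirical T n E p) =
      ∑ x ∈ E, p x * ∫ y, f y ∂(empirical T x n : Measure X) := by
  rw [weightedEmpirical, integral_finsetSum_measure fun x hx =>
    (hf x hx).smul_measure ENNReal.ofReal_ne_top]
  refine Finset.sum_congr rfl fun x hx => ?_
  rw [integral_smul_measure, ENNReal.toReal_ofReal (hp x hx).le, smul_eq_mul]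

variable [MetricSpace X] [BorelSpace X]

theorem integral_empirical (T : X → X) (x : X) {n : ℕ} (hn : n ≠ 0) (f : X → ℝ) :
    ∫ y, f y ∂(empirical T x n : Measure X) = (n : ℝ)⁻¹ * birkhoff T f n x := by
  rw [coe_empirical T x hn, integral_smul_measure,
    integral_finsetSum_measure fun j _ => integrable_dirac (by simp)]
  simp [birkhoff]

theorem real_weightedEmpirical (T : X → X) {n : ℕ} (hn : n ≠ 0) {E : Finset X} {p : X → ℝ}
    (hp : ∀ x ∈ E, 0 < p x) {A : Set X} (hA : MeasurableSet A) :
    (weightedEmpirical T n E p A).toReal =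
      (n : ℝ)⁻¹ * ∑ j ∈ Finset.range n, ∑ x ∈ E, p x * A.indicator 1 (T^[j] x) := by
  have h1 : (weightedEmpirical T n E p A).toReal =
      ∫ y, A.indicator 1 y ∂(weightedEmpirical T n E p) := by
    rw [integral_indicator_one hA, measureReal_def]
  rw [h1, integral_weightedEmpirical T n hp (f := A.indicator 1) fun x _ =>
    (integrable_const (1 : ℝ)).indicator hA]
  simp_rw [integral_empirical T _ hn, birkhoff]
  rw [Finset.sum_comm, Finset.mul_sum]
  refine Finset.sum_congr rfl fun x _ => ?_
  rw [← Finset.mul_sum]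
  ring

theorem abs_integral_comp_sub_integral_weightedEmpirical_le [CompactSpace X] {T : X → X}
    (hcont : Continuous T) {n : ℕ}
    (hn : n ≠ 0) {E : Finset X} {p : X → ℝ} (hp : ∀ x ∈ E, 0 < p x) (hsum : ∑ x ∈ E, p x = 1)
    {f : X → ℝ} (hf : Continuous f) {M : ℝ} (hM : ∀ x, |f x| ≤ M) :
    |∫ y, f (T y) ∂(weightedEmpirical T n E p) - ∫ y, f y ∂(weightedEmpirical T n E p)| ≤
      2 * M * (n : ℝ)⁻¹ := by
  have hintegrable : ∀ g : X → ℝ, Continuous g → ∀ ρ : ProbabilityMeasure X,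
      Integrable g (ρ : Measure X) := fun g hg ρ =>
    hg.integrable_of_hasCompactSupport (HasCompactSupport.of_compactSpace _)
  rw [integral_weightedEmpirical T n hp (f := fun y => f (T y)) fun x _ =>
      hintegrable _ (hf.comp hcont) _,
    integral_weightedEmpirical T n hp fun x _ => hintegrable _ hf _, ← Finset.sum_sub_distrib]
  calc _ ≤ ∑ x ∈ E, p x * (2 * M * (n : ℝ)⁻¹) := by
        refine (Finset.abs_sum_le_sum_abs _ _).trans (Finset.sum_le_sum fun x hx => ?_)
        rw [← mul_sub, abs_mul, abs_of_pos (hp x hx)]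
        refine mul_le_mul_of_nonneg_left ?_ (hp x hx).le
        rw [integral_empirical T x hn (fun y => f (T y)), integral_empirical T x hn, ← mul_sub]
        have : birkhoff T (fun y => f (T y)) n x - birkhoff T f n x = f (T^[n] x) - f x := by
          simp only [birkhoff, ← Finset.sum_sub_distrib, ← Function.iterate_succ_apply' T]
          exact Finset.sum_range_sub (fun j => f (T^[j] x)) n
        rw [this, abs_mul, abs_of_nonneg (by positivity), mul_comm]
        gcongr
        exact (abs_sub _ _).trans (by linarith [hM (T^[n] x), hM x])
    _ = _ := by rw [← Finset.sum_mul, hsum, one_mul]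

end WeightedEmpirical

section FiniteVariational

variable {X : Type*}

/-- The Gibbs weights on the finite set `E` associated with the energy `S`. -/
noncomputable def gibbsWeight (E : Finset X) (S : X → ℝ) (x : X) : ℝ :=
  Real.exp (S x) / ∑ y ∈ E, Real.exp (S y)

theorem gibbsWeight_pos {E : Finset X} (S : X → ℝ) {x : X} (hx : x ∈ E) :
    0 < gibbsWeight E S x :=
  div_pos (Real.exp_pos _) (Finset.sum_pos (fun _ _ => Real.exp_pos _) ⟨x, hx⟩)

theorem sum_gibbsWeight {E : Finset X} (hE : E.Nonempty) (S : X → ℝ) :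
    ∑ x ∈ E, gibbsWeight E S x = 1 := by
  simp only [gibbsWeight]
  rw [← Finset.sum_div]
  exact div_self (Finset.sum_pos (fun _ _ => Real.exp_pos _) hE).ne'

theorem neg_sum_gibbsWeight_mul_log {E : Finset X} (hE : E.Nonempty) (S : X → ℝ) :
    -∑ x ∈ E, gibbsWeight E S x * Real.log (gibbsWeight E S x) =
      Real.log (∑ x ∈ E, Real.exp (S x)) - ∑ x ∈ E, gibbsWeight E S x * S x := by
  have h : ∀ x, Real.log (gibbsWeight E S x) = S x - Real.log (∑ y ∈ E, Real.exp (S y)) :=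
    fun x => by
      rw [gibbsWeight, Real.log_div (Real.exp_ne_zero _)
        (Finset.sum_pos (fun _ _ => Real.exp_pos _) hE).ne', Real.log_exp]
  simp_rw [h, mul_sub, Finset.sum_sub_distrib, ← Finset.sum_mul, sum_gibbsWeight hE S]
  ring

variable [MetricSpace X] [MeasurableSpace X] [BorelSpace X]

theorem log_sum_exp_sub_integral_le_dynEnt [CompactSpace X] {T : X → X} (hcont : Continuous T)
    {φ : X → ℝ} (hφ : Continuous φ)
    {n : ℕ} (hn : n ≠ 0) {E : Finset X} (hE : E.Nonempty) {δ : ℝ} (hsep : IsSeparated T n δ E)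
    {k : ℕ} {P : Fin k → Set X} (hPm : ∀ i, MeasurableSet (P i))
    (hPd : Pairwise (Function.onFun Disjoint P)) (hPc : ⋃ i, P i = univ)
    (hPδ : ∀ i, ∀ x ∈ P i, ∀ y ∈ P i, dist x y ≤ δ) (q : ℕ) :
    q * (Real.log (∑ x ∈ E, Real.exp (birkhoff T φ n x)) -
        n * ∫ y, φ y ∂(weightedEmpirical T n E (gibbsWeight E (birkhoff T φ n)))) ≤
      q * (q * Real.log k) +
        n * dynEnt T (weightedEmpirical T n E (gibbsWeight E (birkhoff T φ n))) P q := by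
  classical
  set p := gibbsWeight E (birkhoff T φ n) with hpdef
  have hp : ∀ x ∈ E, 0 < p x := fun x hx => gibbsWeight_pos _ hx
  have hcode : ∀ x, ∃ i, x ∈ P i := fun x => mem_iUnion.1 (hPc ▸ mem_univ x)
  choose code hcode using hcode
  have hiff : ∀ x i, x ∈ P i ↔ code x = i := fun x i => by
    refine ⟨fun h => ?_, fun h => h ▸ hcode x⟩
    by_contra hne
    exact disjoint_left.1 (hPd hne) (hcode x) h
  set c : X → ℕ → Fin k := fun x j => code (T^[j] x) with hc
  have hinj : InjOn (window c 0 n) E := by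
    intro x hx y hy hxy
    by_contra hne
    obtain ⟨j, hj, hd⟩ := hsep x hx y hy hne
    have := window_eq_iff.1 hxy j (Nat.zero_le _) (by omega)
    exact absurd (hPδ _ _ (hcode (T^[j] x)) _ ((hiff _ _).2 this.symm)) (not_le.2 hd)
  have key := mul_entropy_le hp (sum_gibbsWeight hE _) c hn q hinj
  rw [neg_sum_gibbsWeight_mul_log hE] at key
  have hintegrable : n * ∫ y, φ y ∂(weightedEmpirical T n E p) =
      ∑ x ∈ E, p x * birkhoff T φ n x := by
    rw [integral_weightedEmpirical T n hp fun x _ =>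
      hφ.integrable_of_hasCompactSupport (HasCompactSupport.of_compactSpace _), Finset.mul_sum]
    refine Finset.sum_congr rfl fun x _ => ?_
    have : (n : ℝ) ≠ 0 := by exact_mod_cast hn
    rw [integral_empirical T x hn]
    field_simp
  rw [hintegrable]
  refine key.trans (le_of_eq ?_)
  rw [dynEnt]
  congr 2
  refine Finset.sum_congr rfl fun a _ => ?_
  have hm : MeasurableSet (⋂ j : Fin q, T^[(j : ℕ)] ⁻¹' P (a j)) :=
    MeasurableSet.iInter fun j => (hcont.iterate j).measurable (hPm _)
  rw [real_weightedEmpirical T hn hp hm]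
  congr 2
  refine Finset.sum_congr rfl fun j _ => ?_
  rw [labelMass, Finset.sum_filter]
  refine Finset.sum_congr rfl fun x _ => ?_
  have : T^[j] x ∈ (⋂ i : Fin q, T^[(i : ℕ)] ⁻¹' P (a i)) ↔ window c j q x = a := by
    simp only [mem_iInter, mem_preimage, hiff, ← Function.iterate_add_apply, funext_iff, window,
      hc, add_comm j]
  by_cases h : window c j q x = a
  · simp [h, this.2 h]
  · simp [h, mt this.1 h]

end FiniteVariational

section VariationalLimit

variable {X : Type*} [MeasurableSpace X]

theorem le_metricEntropy_of_forall_mul_le {T : X → X} {μ : Measure X} {k : ℕ} {P : Fin k → Set X}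
    (hPm : ∀ i, MeasurableSet (P i)) (hPd : Pairwise (Function.onFun Disjoint P))
    (hPc : ⋃ i, P i = univ) {b : ℝ} (h : ∀ q : ℕ, q * b ≤ dynEnt T μ P q) :
    (b : EReal) ≤ metricEntropy T μ := by
  refine le_trans ?_ (le_iSup_of_le k (le_iSup_of_le P (le_iSup_of_le hPm (le_iSup_of_le hPd
    (le_iSup_of_le hPc le_rfl)))))
  refine le_liminf_of_le (by isBoundedDefault) ?_
  filter_upwards [eventually_gt_atTop 0] with q hq
  have hq0 : (0 : ℝ) < q := by exact_mod_cast hq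
  rw [EReal.coe_le_coe_iff, ← div_eq_inv_mul, le_div_iff₀' hq0]
  exact h q

variable [MetricSpace X] [BorelSpace X]

theorem invariantProb_of_integral_comp_eq {T : X → X} (hcont : Continuous T)
    {μ : ProbabilityMeasure X}
    (h : ∀ f : X → ℝ, Continuous f → ∫ x, f (T x) ∂(μ : Measure X) = ∫ x, f x ∂(μ : Measure X)) :
    InvariantProb T μ := by
  have : IsProbabilityMeasure ((μ : Measure X).map T) :=
    Measure.isProbabilityMeasure_map hcont.aemeasurable
  refine ext_of_forall_integral_eq_of_IsFiniteMeasure fun f => ?_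
  rw [integral_map hcont.aemeasurable f.continuous.aestronglyMeasurable]
  exact h f f.continuous

theorem tendsto_dynEnt_of_null_frontier {T : X → X} (hcont : Continuous T) {ι : Type*}
    {L : Filter ι} {m : ι → ProbabilityMeasure X} {μ : ProbabilityMeasure X}
    (h : Tendsto m L (𝓝 μ)) (hμ : InvariantProb T μ) {k : ℕ} {P : Fin k → Set X}
    (hP : ∀ i, (μ : Measure X) (frontier (P i)) = 0) (q : ℕ) :
    Tendsto (fun i => dynEnt T (m i : Measure X) P q) L (𝓝 (dynEnt T (μ : Measure X) P q)) := by
  have hmp : MeasurePreserving T (μ : Measure X) (μ : Measure X) := ⟨hcont.measurable, hμ⟩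
  refine tendsto_finsetSum _ fun c _ => ?_
  refine (Real.continuous_negMulLog.tendsto _).comp
    ((ENNReal.tendsto_toReal (measure_ne_top _ _)).comp
      (ProbabilityMeasure.tendsto_measure_of_null_frontier_of_tendsto' h ?_))
  refine measure_frontier_iInter_eq_zero fun j => measure_mono_null
    (Continuous.frontier_preimage_subset (hcont.iterate j) _) ?_
  rw [(hmp.iterate j).measure_preimage isClosed_frontier.nullMeasurableSet]
  exact hP _

variable [CompactSpace X]

theorem tendsto_integral_of_continuous {ι : Type*} {L : Filter ι} {m : ι → ProbabilityMeasure X}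
    {μ : ProbabilityMeasure X} (h : Tendsto m L (𝓝 μ)) {f : X → ℝ} (hf : Continuous f) :
    Tendsto (fun i => ∫ x, f x ∂(m i : Measure X)) L (𝓝 (∫ x, f x ∂(μ : Measure X))) :=
  ProbabilityMeasure.tendsto_iff_forall_integral_tendsto.1 h
    (BoundedContinuousFunction.mkOfCompact ⟨f, hf⟩)

/-- Weighted averages of empirical measures belonging to `V` at a common time belong to `V`. -/
def StableUnderAveraging (T : X → X) (V : Set (ProbabilityMeasure X)) : Prop :=
  ∀ (n : ℕ) (E : Finset X) (p : X → ℝ), (∀ x ∈ E, 0 < p x) → ∑ x ∈ E, p x = 1 →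
    (∀ x ∈ E, empirical T x n ∈ V) → ∀ m : ProbabilityMeasure X,
      (m : Measure X) = weightedEmpirical T n E p → m ∈ V

/-- If separated sets, all of whose points have empirical measures in a closed set `V` that is
stable under averaging, carry exponential mass `exp (n a)` for infinitely many `n`, then `V`
contains an invariant measure of free energy at least `a`. -/
theorem exists_invariant_of_frequently_separated {T : X → X} (hcont : Continuous T)
    {φ : X → ℝ} (hφ : Continuous φ) {δ : ℝ} (hδ : 0 < δ) {V : Set (ProbabilityMeasure X)}
    (hVc : IsClosed V)
    (hV : StableUnderAveraging T V) {a : ℝ}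
    (h : ∃ᶠ n : ℕ in atTop, ∃ E : Finset X, IsSeparated T n δ E ∧
      (∀ x ∈ E, empirical T x n ∈ V) ∧
        Real.exp (n * a) ≤ ∑ x ∈ E, Real.exp (birkhoff T φ n x)) :
    ∃ μ ∈ V, InvariantProb T μ ∧
      (a : EReal) ≤ metricEntropy T (μ : Measure X) + ((∫ x, φ x ∂(μ : Measure X) : ℝ) : EReal) := by
  set Q : ℕ → ProbabilityMeasure X → Prop := fun n m => n ≠ 0 ∧ m ∈ V ∧
    (∀ (k : ℕ) (P : Fin k → Set X), (∀ i, MeasurableSet (P i)) →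
      Pairwise (Function.onFun Disjoint P) → ⋃ i, P i = univ →
      (∀ i, ∀ x ∈ P i, ∀ y ∈ P i, dist x y ≤ δ) → ∀ q : ℕ,
        q * (n * a - n * ∫ y, φ y ∂(m : Measure X)) ≤
          q * (q * Real.log k) + n * dynEnt T (m : Measure X) P q) ∧
    (∀ f : X → ℝ, Continuous f → ∀ M : ℝ, (∀ x, |f x| ≤ M) →
      |∫ y, f (T y) ∂(m : Measure X) - ∫ y, f y ∂(m : Measure X)| ≤ 2 * M * (n : ℝ)⁻¹) with hQ
  have hfreq : ∃ᶠ n in atTop, ∃ m, Q n m := by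
    refine (h.and_eventually (eventually_ne_atTop 0)).mono ?_
    rintro n ⟨⟨E, hsep, hEV, hZ⟩, hn⟩
    have hE : E.Nonempty := by
      by_contra hne
      rw [Finset.not_nonempty_iff_eq_empty] at hne
      rw [hne, Finset.sum_empty] at hZ
      exact absurd hZ (not_le.2 (Real.exp_pos _))
    have hp : ∀ x ∈ E, 0 < gibbsWeight E (birkhoff T φ n) x := fun x hx => gibbsWeight_pos _ hx
    have hsum := sum_gibbsWeight hE (birkhoff T φ n)
    refine ⟨⟨weightedEmpirical T n E (gibbsWeight E (birkhoff T φ n)),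
      isProbabilityMeasure_weightedEmpirical T n hp hsum⟩, hn, hV n E _ hp hsum hEV _ rfl, ?_, ?_⟩
    · intro k P hPm hPd hPc hPδ q
      refine le_trans ?_ (log_sum_exp_sub_integral_le_dynEnt hcont hφ hn hE hsep hPm hPd hPc hPδ q)
      have hlog : n * a ≤ Real.log (∑ x ∈ E, Real.exp (birkhoff T φ n x)) := by
        rw [← Real.log_exp (n * a)]
        exact Real.log_le_log (Real.exp_pos _) hZ
      exact mul_le_mul_of_nonneg_left (sub_le_sub_right hlog _) (Nat.cast_nonneg q)
    · intro f hf M hM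
      exact abs_integral_comp_sub_integral_weightedEmpirical_le hcont hn hp hsum hf hM
  have hne : Nonempty (ProbabilityMeasure X) := let ⟨_, m, _⟩ := hfreq.exists; ⟨m⟩
  have hneBot := frequently_iff_neBot.1 hfreq
  set L : Ultrafilter ℕ := Ultrafilter.of (atTop ⊓ 𝓟 {n | ∃ m, Q n m}) with hL
  have hL' : (L : Filter ℕ) ≤ atTop ⊓ 𝓟 {n | ∃ m, Q n m} := Ultrafilter.of_le _
  have hLtop : (L : Filter ℕ) ≤ atTop := hL'.trans inf_le_left
  have hm : ∀ n, ∃ m, (∃ m, Q n m) → Q n m := fun n => by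
    by_cases h : ∃ m, Q n m
    · exact ⟨h.choose, fun _ => h.choose_spec⟩
    · exact ⟨hne.some, fun h' => absurd h' h⟩
  choose m hm using hm
  have hQm : ∀ᶠ n in (L : Filter ℕ), Q n (m n) :=
    Filter.mem_of_superset (le_principal_iff.1 (hL'.trans inf_le_right)) hm
  obtain ⟨μ, -, hμ⟩ := (isCompact_univ (X := ProbabilityMeasure X)).ultrafilter_le_nhds (L.map m)
    (by simp)
  replace hμ : Tendsto m L (𝓝 μ) := hμ
  have hinv0 : Tendsto (fun n : ℕ => (n : ℝ)⁻¹) L (𝓝 0) :=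
    tendsto_inv_atTop_nhds_zero_nat.mono_left hLtop
  have hinv : InvariantProb T μ := by
    refine invariantProb_of_integral_comp_eq hcont fun f hf => ?_
    obtain ⟨M, hM⟩ := isCompact_univ.exists_bound_of_continuousOn hf.continuousOn
    have h1 := (tendsto_integral_of_continuous hμ (hf.comp hcont)).sub
      (tendsto_integral_of_continuous hμ hf)
    have h2 : Tendsto (fun n => ∫ x, f (T x) ∂(m n : Measure X) - ∫ x, f x ∂(m n : Measure X)) L
        (𝓝 0) := by
      refine squeeze_zero_norm' (a := fun n : ℕ => 2 * M * (n : ℝ)⁻¹) ?_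
        (by simpa using hinv0.const_mul (2 * M))
      filter_upwards [hQm] with n hn
      exact hn.2.2.2 f hf M fun x => hM x (mem_univ x)
    exact sub_eq_zero.1 (tendsto_nhds_unique h1 h2)
  refine ⟨μ, hVc.mem_of_tendsto hμ (hQm.mono fun n hn => hn.2.1), hinv, ?_⟩
  obtain ⟨k, P, hPm, hPd, hPc, hPδ, hP0⟩ := exists_partition_null_frontier (μ : Measure X) hδ
  have hent : ∀ q : ℕ, q * (a - ∫ x, φ x ∂(μ : Measure X)) ≤ dynEnt T (μ : Measure X) P q := by
    intro q
    have h1 := ((tendsto_integral_of_continuous hμ hφ).const_sub a).const_mul (q : ℝ)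
    have h2 := (hinv0.const_mul (q * (q * Real.log k))).add
      (tendsto_dynEnt_of_null_frontier hcont hμ hinv hP0 q)
    rw [mul_zero, zero_add] at h2
    refine le_of_tendsto_of_tendsto h1 h2 ?_
    filter_upwards [hQm] with n hn
    have h3 := hn.2.2.1 k P hPm hPd hPc hPδ q
    have hn0 : (0 : ℝ) < n := by exact_mod_cast Nat.pos_of_ne_zero hn.1
    rw [← mul_le_mul_iff_right₀ hn0, mul_add, mul_left_comm (n : ℝ) _ (n : ℝ)⁻¹,
      mul_inv_cancel₀ hn0.ne']
    linarith
  have h4 := le_metricEntropy_of_forall_mul_le hPm hPd hPc hent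
  calc (a : EReal) = ((a - ∫ x, φ x ∂(μ : Measure X) : ℝ) : EReal) +
        ((∫ x, φ x ∂(μ : Measure X) : ℝ) : EReal) := by
          rw [← EReal.coe_add, sub_add_cancel]
    _ ≤ _ := by gcongr

end VariationalLimit

section MaximalSeparated

variable {X : Type*} [MetricSpace X] [CompactSpace X]

theorem IsSeparated.finite {T : X → X} (hcont : Continuous T) {n : ℕ} {δ : ℝ} (hδ : 0 < δ)
    {E : Set X} (hE : IsSeparated T n δ E) : E.Finite := by
  have h : ∀ j, ∃ δ' > 0, ∀ x y : X, dist x y < δ' → dist (T^[j] x) (T^[j] y) < δ := fun j =>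
    (Metric.uniformContinuous_iff.1
      (CompactSpace.uniformContinuous_of_continuous (hcont.iterate j)) δ hδ).imp
        fun _ h => ⟨h.1, fun _ _ h' => h.2 h'⟩
  choose δ' hδ' h using h
  have hex : ∃ b > 0, ∀ j < n, b ≤ δ' j := by
    clear hE
    induction n with
    | zero => exact ⟨1, one_pos, by simp⟩
    | succ n ih =>
      obtain ⟨b, hb, hb'⟩ := ih
      refine ⟨min b (δ' n), lt_min hb (hδ' n), fun j hj => ?_⟩
      rcases Nat.lt_succ_iff_lt_or_eq.1 hj with hj | rfl
      · exact (min_le_left _ _).trans (hb' j hj)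
      · exact min_le_right _ _
  obtain ⟨b, hb, hb'⟩ := hex
  refine finite_of_pairwise_dist hb fun x hx y hy hxy => ?_
  by_contra hne
  obtain ⟨j, hj, hd⟩ := hE x hx y hy hne
  exact lt_asymm hd (h j x y (hxy.trans_le (hb' j hj)))

theorem exists_finset_separated_subset_cover {T : X → X} (hcont : Continuous T) (n : ℕ) {δ : ℝ}
    (hδ : 0 < δ) (A : Set X) :
    ∃ E : Finset X, ↑E ⊆ A ∧ IsSeparated T n δ E ∧ A ⊆ ⋃ x ∈ E, dynBall T x n δ := by
  obtain ⟨E, hE⟩ := zorn_subset {S : Set X | S ⊆ A ∧ IsSeparated T n δ S} fun c hcS hc =>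
    ⟨⋃₀ c, ⟨sUnion_subset fun s hs => (hcS hs).1, by
      rintro x ⟨s, hs, hxs⟩ y ⟨t, ht, hyt⟩ hxy
      rcases hc.total hs ht with h | h
      · exact (hcS ht).2 x (h hxs) y hyt hxy
      · exact (hcS hs).2 x hxs y (h hyt) hxy⟩, fun s hs => subset_sUnion_of_mem hs⟩
  have hfin := hE.prop.2.finite hcont hδ
  refine ⟨hfin.toFinset, by simpa using hE.prop.1, by simpa using hE.prop.2, fun x hx => ?_⟩
  by_contra hcov
  simp only [Finite.mem_toFinset, mem_iUnion, exists_prop, not_exists, not_and] at hcov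
  have hsep : ∀ y ∈ E, ∃ j < n, δ < dist (T^[j] y) (T^[j] x) := fun y hy => by
    simpa [dynBall] using hcov y hy
  have hins : insert x E ∈ {S : Set X | S ⊆ A ∧ IsSeparated T n δ S} := by
    refine ⟨insert_subset hx hE.prop.1, ?_⟩
    rintro y (rfl | hy) z (rfl | hz) hyz
    · exact absurd rfl hyz
    · simpa only [dist_comm] using hsep z hz
    · exact hsep y hy
    · exact hE.prop.2 y hy z hz hyz
  have hxE : x ∈ E := hE.le_of_ge hins (subset_insert x E) (mem_insert x E)
  exact hcov x hxE fun j _ => by simpa using hδ.le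

end MaximalSeparated

section WeakNeighborhoods

variable {X : Type*} [MetricSpace X] [MeasurableSpace X] [BorelSpace X]

open scoped BoundedContinuousFunction in
theorem nhds_eq_comap_integral (μ : ProbabilityMeasure X) :
    𝓝 μ = comap (fun (ρ : ProbabilityMeasure X) (f : X →ᵇ ℝ) => ∫ x, f x ∂(ρ : Measure X))
      (𝓝 fun f : X →ᵇ ℝ => ∫ x, f x ∂(μ : Measure X)) := by
  refine le_antisymm (tendsto_iff_comap.1 (tendsto_pi_nhds.2
    (ProbabilityMeasure.tendsto_iff_forall_integral_tendsto.1 tendsto_id))) ?_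
  exact ProbabilityMeasure.tendsto_iff_forall_integral_tendsto.2 (tendsto_pi_nhds.1 tendsto_comap)

theorem exists_closed_nhds_stableUnderAveraging (T : X → X) {μ : ProbabilityMeasure X}
    {s : Set (ProbabilityMeasure X)} (hs : s ∈ 𝓝 μ) :
    ∃ V ∈ 𝓝 μ, IsClosed V ∧ V ⊆ s ∧ StableUnderAveraging T V := by
  have hs' := hs
  rw [nhds_eq_comap_integral, mem_comap] at hs'
  obtain ⟨t, ht, hts⟩ := hs'
  rw [nhds_pi, (hasBasis_pi fun _ => Metric.nhds_basis_closedBall).mem_iff] at ht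
  obtain ⟨⟨I, b⟩, ⟨hI, hb⟩, hbt⟩ := ht
  have hcont : Continuous fun (ρ : ProbabilityMeasure X)
      (f : BoundedContinuousFunction X ℝ) => ∫ x, f x ∂(ρ : Measure X) :=
    continuous_iff_continuousAt.2 fun ρ => tendsto_iff_comap.2 (nhds_eq_comap_integral ρ).le
  refine ⟨_, hcont.continuousAt.preimage_mem_nhds
    (set_pi_mem_nhds hI fun f hf => Metric.closedBall_mem_nhds _ (hb f hf)),
    (isClosed_set_pi fun f _ => Metric.isClosed_closedBall).preimage hcont,
    (preimage_mono hbt).trans hts, ?_⟩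
  intro n E p hp hsum hE m hm f hf
  simp only
  rw [hm, integral_weightedEmpirical T n hp fun x _ => f.integrable _]
  exact (convex_closedBall _ _).sum_mem (fun x hx => (hp x hx).le) hsum fun x hx => hE x hx f hf

end WeakNeighborhoods

section LargeDeviations

variable {X : Type*} [MetricSpace X] [MeasurableSpace X] [BorelSpace X]

theorem IsWeakStarMetric.nonneg {dP : ProbabilityMeasure X → ProbabilityMeasure X → ℝ}
    (hdP : IsWeakStarMetric dP) (μ ρ : ProbabilityMeasure X) : 0 ≤ dP μ ρ := by
  have h1 := hdP.2.2.1 μ ρ μ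
  rw [(hdP.2.1 μ μ).2 rfl, hdP.1 ρ μ] at h1
  linarith

variable [CompactSpace X]

theorem IsConformal.eventually_measure_empirical_mem_le {T : X → X} (hcont : Continuous T)
    (hopen : IsOpenMap T) (hde : DistanceExpanding T) (htr : TopTransitive T)
    {φ : X → ℝ} (hφ : Continuous φ) {ν : Measure X} [IsProbabilityMeasure ν] {lam : ℝ}
    (hν : IsConformal T φ ν lam) {r ε : ℝ} (hε : 0 < ε) {V : Set (ProbabilityMeasure X)}
    (hVc : IsClosed V) (hV : StableUnderAveraging T V) (hVK : Disjoint V (Kset T φ r)) :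
    ∀ᶠ n : ℕ in atTop,
      ν {x | empirical T x n ∈ V} ≤ ENNReal.ofReal (Real.exp (n * (ε - r))) := by
  by_contra hcon
  have hlam := hν.1
  obtain ⟨l, η, hl, hη, hexp⟩ := id hde
  obtain ⟨δ₀, hδ₀, hosc⟩ := Metric.uniformContinuous_iff.1
    (CompactSpace.uniformContinuous_of_continuous hφ) (ε / 2) (half_pos hε)
  set δ := min η δ₀ / 2 with hδdef
  have hδ : 0 < δ := half_pos (lt_min hη hδ₀)
  have hδη : 2 * δ ≤ η := by
    rw [hδdef, mul_div_cancel₀ _ two_ne_zero]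
    exact min_le_left _ _
  have hγ : ∀ x y, dist x y < 2 * δ → φ y ≤ φ x + ε / 2 := fun x y hxy => by
    rw [hδdef, mul_div_cancel₀ _ two_ne_zero] at hxy
    have := hosc (hxy.trans_le (min_le_right _ _))
    rw [Real.dist_eq, abs_lt] at this
    linarith
  obtain ⟨μ, hμV, hμ, hle⟩ := exists_invariant_of_frequently_separated hcont hφ hδ hVc hV
    (a := Real.log lam + ε / 2 - r) <| (not_eventually.1 hcon).mono fun n hn => by
      obtain ⟨E, hEV, hE, hcov⟩ :=
        exists_finset_separated_subset_cover hcont n hδ {x | empirical T x n ∈ V}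
      refine ⟨E, hE, fun x hx => hEV hx, ?_⟩
      have h1 : ν {x | empirical T x n ∈ V} ≤ ENNReal.ofReal
          (∑ x ∈ E, Real.exp (birkhoff T φ n x + n * (ε / 2)) / lam ^ n) := by
        refine (measure_mono hcov).trans ((measure_biUnion_finset_le _ _).trans ?_)
        rw [ENNReal.ofReal_sum_of_nonneg fun x _ => by positivity]
        refine Finset.sum_le_sum fun x _ => ?_
        rw [← ofReal_measureReal]
        exact ENNReal.ofReal_le_ofReal
          (hν.measure_dynBall_le hcont hl hexp hδ hδη hγ n x)
      have h2 := (ENNReal.ofReal_le_ofReal_iff (Finset.sum_nonneg fun x _ => by positivity)).1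
        ((not_le.1 hn).le.trans h1)
      simp_rw [Real.exp_add] at h2
      rw [← Finset.sum_div, ← Finset.sum_mul, le_div_iff₀ (by positivity)] at h2
      have h3 : lam ^ n = Real.exp (n * Real.log lam) := by
        rw [mul_comm, Real.exp_mul, Real.exp_log hlam, Real.rpow_natCast]
      rw [h3, ← Real.exp_add] at h2
      rw [← mul_le_mul_iff_left₀ (Real.exp_pos (n * (ε / 2))), ← Real.exp_add]
      refine le_trans (le_of_eq ?_) h2
      ring_nf
  refine disjoint_left.1 hVK hμV ⟨hμ, le_trans ?_ hle⟩
  calc topPressure T φ - (r : EReal) ≤ ((Real.log lam + ε / 2 : ℝ) : EReal) - (r : EReal) :=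
        EReal.sub_le_sub (hν.topPressure_le hcont hopen hde htr hφ (half_pos hε)) le_rfl
    _ = _ := by rw [← EReal.coe_sub]

theorem IsConformal.exists_measure_forall_le_dist_le {T : X → X} (hcont : Continuous T)
    (hopen : IsOpenMap T) (hde : DistanceExpanding T) (htr : TopTransitive T)
    {dP : ProbabilityMeasure X → ProbabilityMeasure X → ℝ} (hdP : IsWeakStarMetric dP)
    {φ : X → ℝ} (hφ : Continuous φ) {ν : Measure X} [IsProbabilityMeasure ν] {lam : ℝ}
    (hν : IsConformal T φ ν lam) {r ε : ℝ} (hε : 0 < ε) :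
    ∃ κ : ℝ, 0 < κ ∧ ∀ᶠ n : ℕ in atTop,
      ν {x | ∀ ρ ∈ Kset T φ r, ε ≤ dP (empirical T x n) ρ} ≤
        ENNReal.ofReal (κ * Real.exp (n * (ε - r))) := by
  have key := (isCompact_univ (X := ProbabilityMeasure X)).induction_on
    (p := fun U => ∃ κ : ℝ, 0 < κ ∧ ∀ᶠ n : ℕ in atTop,
      ν {x | empirical T x n ∈ U ∧ ∀ ρ ∈ Kset T φ r, ε ≤ dP (empirical T x n) ρ} ≤
        ENNReal.ofReal (κ * Real.exp (n * (ε - r))))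
    ?_ ?_ ?_ ?_
  · simpa using key
  · exact ⟨1, one_pos, by simp⟩
  · rintro s t hst ⟨κ, hκ, h⟩
    refine ⟨κ, hκ, h.mono fun n hn => le_trans (measure_mono ?_) hn⟩
    exact fun x hx => ⟨hst hx.1, hx.2⟩
  · rintro s t ⟨κ, hκ, h⟩ ⟨κ', hκ', h'⟩
    refine ⟨κ + κ', add_pos hκ hκ', ?_⟩
    filter_upwards [h, h'] with n hn hn'
    rw [add_mul, ENNReal.ofReal_add (by positivity) (by positivity)]
    refine (measure_mono ?_).trans ((measure_union_le _ _).trans (add_le_add hn hn'))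
    rintro x ⟨hx | hx, hx'⟩
    · exact Or.inl ⟨hx, hx'⟩
    · exact Or.inr ⟨hx, hx'⟩
  · intro μ _
    have hnhds : {ρ | dP ρ μ < ε / 2} ∈ 𝓝 μ :=
      (hdP.2.2.2 μ _).2 ⟨ε / 2, half_pos hε, subset_rfl⟩
    obtain ⟨V, hVμ, hVc, hVs, hV⟩ := exists_closed_nhds_stableUnderAveraging T hnhds
    refine ⟨V, mem_nhdsWithin_of_mem_nhds hVμ, 1, one_pos, ?_⟩
    by_cases hVK : Disjoint V (Kset T φ r)
    · filter_upwards [hν.eventually_measure_empirical_mem_le hcont hopen hde htr hφ hε hVc hV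
        hVK] with n hn
      rw [one_mul]
      exact (measure_mono fun x hx => hx.1).trans hn
    · obtain ⟨ρ, hρV, hρK⟩ := not_disjoint_iff.1 hVK
      refine Eventually.of_forall fun n => ?_
      have : {x | empirical T x n ∈ V ∧ ∀ ρ ∈ Kset T φ r, ε ≤ dP (empirical T x n) ρ} = ∅ := by
        refine eq_empty_of_forall_notMem fun x hx => ?_
        have h1 := hdP.2.2.1 (empirical T x n) μ ρ
        have h2 : dP (empirical T x n) μ < ε / 2 := hVs hx.1
        have h3 : dP ρ μ < ε / 2 := hVs hρV
        rw [hdP.1 μ ρ] at h1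
        linarith [hx.2 ρ hρK]
      rw [this, measure_empty]
      exact bot_le

end LargeDeviations

/-- **Proposition (large deviations lemma).** For a conformal measure `ν` of an open
distance expanding topologically transitive map, the `ν`-measure of the set of points whose
time-`n` empirical measure stays `ε`-away from `K_r(φ)` decays exponentially. -/
theorem large_deviations_for_conformal_measures
    {X : Type*} [MetricSpace X] [CompactSpace X] [MeasurableSpace X] [BorelSpace X]
    (T : X → X) (hcont : Continuous T) (hopen : IsOpenMap T)
    (hde : DistanceExpanding T) (htr : TopTransitive T)
    (dP : ProbabilityMeasure X → ProbabilityMeasure X → ℝ) (hdP : IsWeakStarMetric dP)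
    (φ : X → ℝ) (hφ : Continuous φ)
    (ν : ProbabilityMeasure X) (lam : ℝ) (hν : IsConformal T φ (ν : Measure X) lam)
    (r : ℝ) (hr : 0 < r) :
    ∀ ε : ℝ, 0 < ε → ε < r → ∃ (n₀ : ℕ) (κ : ℝ), 1 ≤ n₀ ∧ 0 < κ ∧
      ∀ n : ℕ, n₀ ≤ n →
        (ν : Measure X)
            {x : X | ε ≤ sInf ((fun ρ => dP (empirical T x n) ρ) '' Kset T φ r)}
          < ENNReal.ofReal (κ * Real.exp ((n : ℝ) * (ε - r))) := by
  intro ε hε _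
  obtain ⟨κ, hκ, h⟩ := hν.exists_measure_forall_le_dist_le hcont hopen hde htr hdP hφ (r := r) hε
  obtain ⟨N, hN⟩ := eventually_atTop.1 h
  refine ⟨max 1 N, κ + 1, le_max_left _ _, by positivity, fun n hn => ?_⟩
  refine lt_of_le_of_lt ((measure_mono fun x hx ρ hρ => ?_).trans
    (hN n ((le_max_right _ _).trans hn))) ?_
  · exact le_trans hx (csInf_le ⟨0, by rintro _ ⟨ρ, -, rfl⟩; exact hdP.nonneg _ _⟩
      (mem_image_of_mem _ hρ))
  · rw [ENNReal.ofReal_lt_ofReal_iff (by positivity)]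
    gcongr
    linarith
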